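/- Let X(n, CJ(G)) ⊆ (ℝ²)ⁿ × ℝⁿ × ℝ² be the set of tuples (p, r, (a, b)) with p₁ = 0 such that (p, r) is a collectively jammed packing of n disks in ℝ²/Λ(a, b) (Λ(a, b) with basis (a, 0), (b, 1/a), a > 0) whose contact graph is a fixed graph G with k edges. Then the Hausdorff dimension of X(n, CJ(G)) is at most 3n − k. -/

import Mathlib

noncomputable section

open scoped RealInnerProductSpace

namespace IsostaticPaper

/-- Points of the Euclidean plane `ℝ²`. -/
abbrev Pt : Type := EuclideanSpace ℝ (Fin 2)

/-- The point `(x, y) ∈ ℝ²`. -/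
def vec (x y : ℝ) : Pt := (WithLp.equiv 2 (Fin 2 → ℝ)).symm ![x, y]

/-- The lattice `Λ ⊆ ℝ²` spanned over `ℤ` by the two vectors `v₁, v₂`. -/
def lat (v₁ v₂ : Pt) : Set Pt :=
  {l : Pt | ∃ z₁ z₂ : ℤ, l = (z₁ : ℝ) • v₁ + (z₂ : ℝ) • v₂}

/-- `(p, r)` is a packing of disks in the flat torus `ℝ²/Λ`:
all radii are positive and `‖pᵢ - pⱼ + λ‖ ≥ rᵢ + rⱼ` for all `i, j` and all
`λ ∈ Λ` with `(j, λ) ≠ (i, 0)`. -/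
def IsPacking (Λ : Set Pt) {ι : Type} (p : ι → Pt) (r : ι → ℝ) : Prop :=
  (∀ i, 0 < r i) ∧
  ∀ i j : ι, ∀ l ∈ Λ, ¬(j = i ∧ l = 0) → r i + r j ≤ ‖p i - p j + l‖

/-- A contact of the packing `(p, r)` is a triple `(i, j, λ)`, `λ ∈ Λ`,
`(j, λ) ≠ (i, 0)`, with `‖pᵢ - pⱼ + λ‖ = rᵢ + rⱼ`. -/
def IsContact (Λ : Set Pt) {ι : Type} (p : ι → Pt) (r : ι → ℝ) (c : ι × ι × Pt) : Prop :=
  c.2.2 ∈ Λ ∧ ¬(c.2.1 = c.1 ∧ c.2.2 = 0) ∧ ‖p c.1 - p c.2.1 + c.2.2‖ = r c.1 + r c.2.1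

/-- A packing `(p, r)` in `ℝ²/Λ` is collectively jammed if every continuous path of
configurations `t ↦ q t`, `t ∈ [0,1]`, starting at `p` and keeping `(q t, r)` a packing,
moves `p` only by translations. -/
def CollectivelyJammed (Λ : Set Pt) {ι : Type} (p : ι → Pt) (r : ι → ℝ) : Prop :=
  ∀ q : ℝ → ι → Pt,
    (∀ i, ContinuousOn (fun t => q t i) (Set.Icc 0 1)) →
    q 0 = p →
    (∀ t ∈ Set.Icc (0:ℝ) 1, IsPacking Λ (q t) r) →
    ∀ t ∈ Set.Icc (0:ℝ) 1, ∀ i j, q t i - p i = q t j - p j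

/-- Euclidean distance between two configurations of centers. -/
def pdist {ι : Type} [Fintype ι] (p q : ι → Pt) : ℝ :=
  Real.sqrt (∑ i, ‖p i - q i‖ ^ 2)

/-- Euclidean distance between two vectors of radii. -/
def rdist {ι : Type} [Fintype ι] (r s : ι → ℝ) : ℝ :=
  Real.sqrt (∑ i, (r i - s i) ^ 2)

/-- Determinant of the pair of lattice basis vectors `v₁, v₂`. -/
def det2 (v₁ v₂ : Pt) : ℝ := v₁ 0 * v₂ 1 - v₁ 1 * v₂ 0

/-- Density of a packing with radii `r` in the torus with lattice basis `v₁, v₂`. -/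
def density (v₁ v₂ : Pt) {ι : Type} [Fintype ι] (r : ι → ℝ) : ℝ :=
  Real.pi * (∑ i, r i ^ 2) / |det2 v₁ v₂|

/-- `(p, r)` is locally maximally dense in the torus with lattice basis `v₁, v₂`:
it is a packing and, for some `ε > 0`, every nearby packing whose radii are a positive
scalar multiple of `r` has density at most that of `(p, r)`. -/
def LocallyMaxDense (v₁ v₂ : Pt) {ι : Type} [Fintype ι] (p : ι → Pt) (r : ι → ℝ) : Prop :=
  IsPacking (lat v₁ v₂) p r ∧
  ∃ ε > 0, ∀ (q : ι → Pt) (t : ℝ), 0 < t →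
    IsPacking (lat v₁ v₂) q (fun i => t * r i) →
    pdist q p < ε → rdist (fun i => t * r i) r < ε →
    density v₁ v₂ (fun i => t * r i) ≤ density v₁ v₂ r

/-- An infinitesimal flex `p'` of the packing: `(pᵢ - pⱼ + λ) · (p'ᵢ - p'ⱼ) ≥ 0`
for every contact `(i, j, λ)`. -/
def IsInfFlex (Λ : Set Pt) {ι : Type} (p : ι → Pt) (r : ι → ℝ) (p' : ι → Pt) : Prop :=
  ∀ c : ι × ι × Pt, IsContact Λ p r c →
    0 ≤ ⟪p c.1 - p c.2.1 + c.2.2, p' c.1 - p' c.2.1⟫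

/-- The packing is infinitesimally rigid if every infinitesimal flex is trivial
(all `p'ᵢ` equal). -/
def InfinitesimallyRigid (Λ : Set Pt) {ι : Type} (p : ι → Pt) (r : ι → ℝ) : Prop :=
  ∀ p' : ι → Pt, IsInfFlex Λ p r p' → ∀ i j, p' i = p' j

/-- The space of equilibrium stresses of a packing whose (finite) set of ordered
contact triples is `K`: scalars on contacts with `ω(i,j,λ) = ω(j,i,-λ)`, vanishing off
`K`, in equilibrium at every vertex. -/
def stressSpace {n : ℕ} (K : Finset (Fin n × Fin n × Pt)) (p : Fin n → Pt) :
    Submodule ℝ ((Fin n × Fin n × Pt) → ℝ) where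
  carrier := {ω | (∀ c ∉ K, ω c = 0) ∧
    (∀ i j l, ω (i, j, l) = ω (j, i, -l)) ∧
    (∀ i, ∑ c ∈ K.filter (fun c => c.1 = i), ω c • (p c.1 - p c.2.1 + c.2.2) = 0)}
  zero_mem' := ⟨fun _ _ => rfl, fun _ _ _ => rfl, fun i => by simp⟩
  add_mem' := by
    rintro ω₁ ω₂ ⟨h1, h2, h3⟩ ⟨g1, g2, g3⟩
    refine ⟨fun c hc => ?_, fun i j l => ?_, fun i => ?_⟩
    · simp [h1 c hc, g1 c hc]
    · simp [h2 i j l, g2 i j l]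
    · simp only [Pi.add_apply, add_smul, Finset.sum_add_distrib, h3 i, g3 i, add_zero]
  smul_mem' := by
    rintro t ω ⟨h1, h2, h3⟩
    refine ⟨fun c hc => ?_, fun i j l => ?_, fun i => ?_⟩
    · simp [h1 c hc]
    · simp [h2 i j l]
    · simp only [Pi.smul_apply, smul_assoc, ← Finset.smul_sum, h3 i, smul_zero]


/-- For `a > 0` and `b`, the unit-determinant lattice `Λ(a, b)` with basis
`(a, 0), (b, 1/a)`. -/
def latAB (a b : ℝ) : Set Pt := lat (vec a 0) (vec b (1 / a))

/-- The lattice vector of `Λ(a, b)` with integer coordinates `z = (z₁, z₂)`. -/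
def lvec (a b : ℝ) (z : ℤ × ℤ) : Pt :=
  (z.1 : ℝ) • vec a 0 + (z.2 : ℝ) • vec b (1 / a)

/-- The contact graph of the packing `(p, r)` in `ℝ²/Λ(a, b)`, with lattice vectors
recorded by their integer coordinates in the basis `(a, 0), (b, 1/a)`. -/
def contactGraphZ (a b : ℝ) {n : ℕ} (p : Fin n → Pt) (r : Fin n → ℝ) :
    Set (Fin n × Fin n × ℤ × ℤ) :=
  {c | ¬(c.2.1 = c.1 ∧ c.2.2 = (0, 0)) ∧
    ‖p c.1 - p c.2.1 + lvec a b c.2.2‖ = r c.1 + r c.2.1}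

/-- The space `X(n, CJ)` of collectively jammed packings of `n` disks:
tuples `(p, r, (a, b))` with `p₁ = 0`, `a > 0`, such that `(p, r)` is a collectively
jammed packing in the torus `ℝ²/Λ(a, b)`. -/
def XnCJ (n : ℕ) (hn : 0 < n) : Set ((Fin n → Pt) × (Fin n → ℝ) × ℝ × ℝ) :=
  {x | x.1 ⟨0, hn⟩ = 0 ∧ 0 < x.2.2.1 ∧
    IsPacking (latAB x.2.2.1 x.2.2.2) x.1 x.2.1 ∧
    CollectivelyJammed (latAB x.2.2.1 x.2.2.2) x.1 x.2.1}

/-- The subset `X(n, CJ(G))` of `X(n, CJ)` of packings with contact graph `G`. -/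
def XnCJG (n : ℕ) (hn : 0 < n) (G : Set (Fin n × Fin n × ℤ × ℤ)) :
    Set ((Fin n → Pt) × (Fin n → ℝ) × ℝ × ℝ) :=
  {x ∈ XnCJ n hn | contactGraphZ x.2.2.1 x.2.2.2 x.1 x.2.1 = G}

section

open Real Set Filter Topology MeasureTheory

/-- An unnormalised `1`-periodic bump concentrating at the integers. -/
def bumpRaw (m : ℕ) (x : ℝ) : ℝ :=
  expNegInvGlue (Real.cos (2 * π * x) - (1 - 1 / ((m : ℝ) + 2)))

/-- The normalised `1`-periodic bump concentrating at the integers. -/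
def bump (m : ℕ) (x : ℝ) : ℝ := bumpRaw m x / ∫ y in (0 : ℝ)..1, bumpRaw m y

lemma bumpRaw_contDiff (m : ℕ) : ContDiff ℝ 1 (bumpRaw m) := by
  unfold bumpRaw
  exact expNegInvGlue.contDiff.comp
    ((Real.contDiff_cos.comp (contDiff_const.mul contDiff_id)).sub contDiff_const)

lemma bumpRaw_nonneg (m : ℕ) (x : ℝ) : 0 ≤ bumpRaw m x := expNegInvGlue.nonneg _

lemma bumpRaw_integral_pos (m : ℕ) : 0 < ∫ y in (0 : ℝ)..1, bumpRaw m y := by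
  refine intervalIntegral.integral_pos zero_lt_one (bumpRaw_contDiff m).continuous.continuousOn
    (fun x _ => bumpRaw_nonneg m x) ⟨0, by simp, ?_⟩
  apply expNegInvGlue.pos_of_pos
  simp only [mul_zero, Real.cos_zero]
  have : (0 : ℝ) < 1 / ((m : ℝ) + 2) := by positivity
  linarith

lemma bump_contDiff (m : ℕ) : ContDiff ℝ 1 (bump m) := (bumpRaw_contDiff m).div_const _

lemma bump_continuous (m : ℕ) : Continuous (bump m) := (bump_contDiff m).continuous

lemma bump_nonneg (m : ℕ) (x : ℝ) : 0 ≤ bump m x :=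
  div_nonneg (bumpRaw_nonneg m x) (bumpRaw_integral_pos m).le

lemma bump_add_one (m : ℕ) (x : ℝ) : bump m (x + 1) = bump m x := by
  unfold bump bumpRaw
  rw [show 2 * π * (x + 1) = 2 * π * x + 2 * π by ring, Real.cos_add_two_pi]

lemma bump_periodic (m : ℕ) : Function.Periodic (bump m) 1 := bump_add_one m

lemma bump_neg (m : ℕ) (x : ℝ) : bump m (-x) = bump m x := by
  unfold bump bumpRaw
  rw [show 2 * π * (-x) = -(2 * π * x) by ring, Real.cos_neg]

lemma bump_integral (m : ℕ) : ∫ x in (0 : ℝ)..1, bump m x = 1 := by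
  unfold bump
  rw [intervalIntegral.integral_div, div_self (bumpRaw_integral_pos m).ne']

lemma bump_intervalIntegrable (m : ℕ) (x y : ℝ) : IntervalIntegrable (bump m) volume x y :=
  (bump_continuous m).intervalIntegrable x y

lemma bump_ne_zero {m : ℕ} {x : ℝ} (h : bump m x ≠ 0) :
    1 - Real.cos (2 * π * x) < 1 / ((m : ℝ) + 2) := by
  by_contra hc
  apply h
  unfold bump bumpRaw
  rw [expNegInvGlue.zero_of_nonpos (by linarith), zero_div]

/-- Smooth `1`-periodic approximation of the sawtooth `1/2 - x`. -/
def saw (m : ℕ) (x : ℝ) : ℝ := (∫ y in (0 : ℝ)..x, bump m y) - x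

lemma saw_hasDerivAt (m : ℕ) (x : ℝ) : HasDerivAt (saw m) (bump m x - 1) x :=
  ((intervalIntegral.integral_hasDerivAt_right (bump_intervalIntegrable m 0 x)
    ((bump_continuous m).stronglyMeasurableAtFilter _ _) (bump_continuous m).continuousAt)).sub
    (hasDerivAt_id x)

lemma saw_continuous (m : ℕ) : Continuous (saw m) :=
  continuous_iff_continuousAt.2 fun x => (saw_hasDerivAt m x).continuousAt

lemma saw_add_one (m : ℕ) (x : ℝ) : saw m (x + 1) = saw m x := by
  unfold saw
  rw [← intervalIntegral.integral_add_adjacent_intervals (bump_intervalIntegrable m 0 x)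
    (bump_intervalIntegrable m x (x + 1)),
    (bump_periodic m).intervalIntegral_add_eq x 0, zero_add, bump_integral]
  ring

lemma saw_periodic (m : ℕ) : Function.Periodic (saw m) 1 := saw_add_one m

lemma saw_neg (m : ℕ) (x : ℝ) : saw m (-x) = -saw m x := by
  unfold saw
  have h := intervalIntegral.integral_comp_neg (fun y => bump m y) (a := 0) (b := x)
  simp only [bump_neg, neg_zero] at h
  rw [h, intervalIntegral.integral_symm (-x) 0]
  ring

lemma saw_integral (m : ℕ) : ∫ x in (0 : ℝ)..1, saw m x = 0 := by
  have h := (saw_periodic m).intervalIntegral_add_eq 0 (-(1 / 2))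
  rw [zero_add] at h
  rw [h, show -(1 / 2 : ℝ) + 1 = 1 / 2 by norm_num]
  have h2 := intervalIntegral.integral_comp_neg (fun y => saw m y) (a := -(1 / 2)) (b := 1 / 2)
  simp only [saw_neg, neg_neg, intervalIntegral.integral_neg] at h2
  linarith

lemma abs_le_of_periodic {f : ℝ → ℝ} {C : ℝ} (hf : Function.Periodic f 1)
    (h : ∀ x ∈ Icc (0 : ℝ) 1, |f x| ≤ C) (x : ℝ) : |f x| ≤ C := by
  have : f x = f (Int.fract x) := by
    have h2 := hf.sub_int_mul_eq (x := x) ⌊x⌋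
    rw [mul_one] at h2
    rw [← h2]; rfl
  rw [this]
  exact h _ ⟨Int.fract_nonneg x, (Int.fract_lt_one x).le⟩

lemma abs_saw_le (m : ℕ) (x : ℝ) : |saw m x| ≤ 1 := by
  refine abs_le_of_periodic (saw_periodic m) (fun x hx => ?_) x
  have h0 : 0 ≤ ∫ y in (0 : ℝ)..x, bump m y :=
    intervalIntegral.integral_nonneg hx.1 fun y _ => bump_nonneg m y
  have h1 : 0 ≤ ∫ y in x..(1 : ℝ), bump m y :=
    intervalIntegral.integral_nonneg hx.2 fun y _ => bump_nonneg m y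
  have h2 := intervalIntegral.integral_add_adjacent_intervals (bump_intervalIntegrable m 0 x)
    (bump_intervalIntegrable m x 1)
  rw [bump_integral] at h2
  unfold saw
  rw [abs_le]
  constructor <;> linarith [hx.1, hx.2]

/-- A primitive of `saw m`, again `1`-periodic. -/
def sawInt (m : ℕ) (x : ℝ) : ℝ := ∫ y in (0 : ℝ)..x, saw m y

lemma sawInt_hasDerivAt (m : ℕ) (x : ℝ) : HasDerivAt (sawInt m) (saw m x) x :=
  intervalIntegral.integral_hasDerivAt_right ((saw_continuous m).intervalIntegrable 0 x)
    ((saw_continuous m).stronglyMeasurableAtFilter _ _) (saw_continuous m).continuousAt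

lemma sawInt_continuous (m : ℕ) : Continuous (sawInt m) :=
  continuous_iff_continuousAt.2 fun x => (sawInt_hasDerivAt m x).continuousAt

lemma sawInt_add_one (m : ℕ) (x : ℝ) : sawInt m (x + 1) = sawInt m x := by
  unfold sawInt
  rw [← intervalIntegral.integral_add_adjacent_intervals
    ((saw_continuous m).intervalIntegrable 0 x)
    ((saw_continuous m).intervalIntegrable x (x + 1)),
    (saw_periodic m).intervalIntegral_add_eq x 0, zero_add, saw_integral, add_zero]

lemma abs_sawInt_le (m : ℕ) (x : ℝ) : |sawInt m x| ≤ 1 := by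
  refine abs_le_of_periodic (sawInt_add_one m) (fun x hx => ?_) x
  unfold sawInt
  have := intervalIntegral.norm_integral_le_of_norm_le_const (a := 0) (b := x) (C := 1)
    (f := saw m) (fun y _ => abs_saw_le m y)
  rw [Real.norm_eq_abs, sub_zero, abs_of_nonneg hx.1] at this
  linarith [hx.2]

/-- The sawtooth function. -/
def sawLim (x : ℝ) : ℝ := 1 / 2 - Int.fract x

/-- A primitive of the sawtooth function. -/
def sawLimInt (x : ℝ) : ℝ := ∫ y in (0 : ℝ)..x, sawLim y

lemma abs_sawLim_le (x : ℝ) : |sawLim x| ≤ 1 := by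
  unfold sawLim
  rw [abs_le]
  constructor <;> linarith [Int.fract_nonneg x, Int.fract_lt_one x]

lemma measurable_sawLim : Measurable sawLim := measurable_const.sub measurable_fract

lemma sawLim_intervalIntegrable (x y : ℝ) : IntervalIntegrable sawLim volume x y := by
  rw [intervalIntegrable_iff]
  refine Measure.integrableOn_of_bounded (M := 1) (by simp) measurable_sawLim.aestronglyMeasurable
    (ae_of_all _ fun t => abs_sawLim_le t)

lemma sawLimInt_continuous : Continuous sawLimInt :=
  intervalIntegral.continuous_primitive (fun a b => sawLim_intervalIntegrable a b) 0

lemma sawLim_continuousAt {x : ℝ} (hx : ∀ k : ℤ, x ≠ k) : ContinuousAt sawLim x := by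
  refine continuousAt_const.sub (continuousAt_fract ?_)
  intro h
  exact hx ⌊x⌋ h

lemma saw_tendsto_of_mem_half {x : ℝ} (h0 : 0 < x) (h1 : x ≤ 1 / 2) :
    Tendsto (fun m => saw m x) atTop (𝓝 (1 / 2 - x)) := by
  have hlim : Tendsto (fun m : ℕ => 1 / ((m : ℝ) + 2)) atTop (𝓝 0) := by
    have := (tendsto_one_div_add_atTop_nhds_zero_nat (𝕜 := ℝ)).comp (tendsto_add_atTop_nat 1)
    refine this.congr fun m => ?_
    simp only [Function.comp]
    push_cast
    ring
  have hc : 0 < 1 - Real.cos (2 * π * x) := by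
    have : Real.cos (2 * π * x) < Real.cos 0 :=
      Real.cos_lt_cos_of_nonneg_of_le_pi le_rfl (by nlinarith [Real.pi_pos])
        (by nlinarith [Real.pi_pos])
    rw [Real.cos_zero] at this
    linarith
  refine tendsto_const_nhds.congr' ?_
  filter_upwards [hlim.eventually_lt_const hc] with m hm
  have hz : ∫ y in x..(1 / 2 : ℝ), bump m y = 0 := by
    rw [intervalIntegral.integral_congr (g := fun _ => (0 : ℝ)), intervalIntegral.integral_zero]
    intro y hy
    rw [uIcc_of_le h1] at hy
    by_contra hne
    have h3 := bump_ne_zero hne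
    have : Real.cos (2 * π * y) ≤ Real.cos (2 * π * x) :=
      Real.cos_le_cos_of_nonneg_of_le_pi (by nlinarith [Real.pi_pos])
        (by nlinarith [Real.pi_pos, hy.2]) (by nlinarith [Real.pi_pos, hy.1])
    linarith
  have h2 := intervalIntegral.integral_add_adjacent_intervals (bump_intervalIntegrable m 0 x)
    (bump_intervalIntegrable m x (1 / 2))
  have h4 : saw m (1 / 2) = 0 := by
    have e1 := saw_add_one m (-(1 / 2))
    rw [show -(1 / 2 : ℝ) + 1 = 1 / 2 by norm_num, saw_neg] at e1
    linarith
  unfold saw at h4 ⊢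
  linarith

lemma saw_tendsto {x : ℝ} (hx : ∀ k : ℤ, x ≠ k) :
    Tendsto (fun m => saw m x) atTop (𝓝 (sawLim x)) := by
  have e : ∀ m, saw m x = saw m (Int.fract x) := fun m => by
    have h2 := (saw_periodic m).sub_int_mul_eq (x := x) ⌊x⌋
    rw [mul_one] at h2
    rw [← h2]; rfl
  have h0 : 0 < Int.fract x := by
    refine lt_of_le_of_ne (Int.fract_nonneg x) fun h => ?_
    exact hx ⌊x⌋ (by rw [Int.fract] at h; linarith)
  simp only [e]
  unfold sawLim
  rcases le_total (Int.fract x) (1 / 2) with h1 | h1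
  · exact saw_tendsto_of_mem_half h0 h1
  · have h := (saw_tendsto_of_mem_half (x := 1 - Int.fract x)
      (by linarith [Int.fract_lt_one x]) (by linarith)).neg
    have e2 : ∀ m, -saw m (1 - Int.fract x) = saw m (Int.fract x) := fun m => by
      rw [← saw_neg, ← saw_add_one]
      congr 1
      ring
    simp only [e2] at h
    convert h using 2
    ring

lemma ae_forall_ne_int (c : ℝ) {d : ℝ} (hd : d ≠ 0) :
    ∀ᵐ t : ℝ, ∀ k : ℤ, c - t * d ≠ k := by
  rw [ae_all_iff]
  intro k
  have : ({(c - k) / d} : Set ℝ)ᶜ ∈ ae (volume : Measure ℝ) :=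
    compl_mem_ae_iff.2 (by simp)
  filter_upwards [this] with t ht h
  apply ht
  rw [mem_singleton_iff, ← h]
  field_simp
  ring

lemma sawInt_tendsto (x : ℝ) : Tendsto (fun m => sawInt m x) atTop (𝓝 (sawLimInt x)) := by
  unfold sawInt sawLimInt
  refine intervalIntegral.tendsto_integral_filter_of_dominated_convergence (fun _ => 1)
    (Eventually.of_forall fun m => (saw_continuous m).aestronglyMeasurable)
    (Eventually.of_forall fun m => ae_of_all _ fun t _ => abs_saw_le m t) (by simp) ?_
  filter_upwards [ae_forall_ne_int 0 (d := -1) (by norm_num)] with t ht _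
  exact saw_tendsto (by simpa using ht)

lemma second_difference_eq_integral {u u' u'' : ℝ → ℝ} (h1 : ∀ s, HasDerivAt u (u' s) s)
    (h2 : ∀ s, HasDerivAt u' (u'' s) s) (hc : Continuous u'') :
    u 1 + u (-1) - 2 * u 0 = ∫ s in (-1 : ℝ)..1, (1 - |s|) * u'' s := by
  have hi : ∀ a b, IntervalIntegrable (fun s => (1 - |s|) * u'' s) volume a b := fun a b =>
    Continuous.intervalIntegrable (by fun_prop) a b
  rw [← intervalIntegral.integral_add_adjacent_intervals (hi (-1) 0) (hi 0 1)]
  have e1 : ∫ s in (-1 : ℝ)..0, (1 - |s|) * u'' s = ∫ s in (-1 : ℝ)..0, (1 + s) * u'' s := by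
    refine intervalIntegral.integral_congr fun s hs => ?_
    rw [uIcc_of_le (by norm_num)] at hs
    simp only [abs_of_nonpos hs.2]
    ring
  have e2 : ∫ s in (0 : ℝ)..1, (1 - |s|) * u'' s = ∫ s in (0 : ℝ)..1, (1 - s) * u'' s := by
    refine intervalIntegral.integral_congr fun s hs => ?_
    rw [uIcc_of_le (by norm_num)] at hs
    simp only [abs_of_nonneg hs.1]
  have d1 : ∀ s ∈ uIcc (-1 : ℝ) 0,
      HasDerivAt (fun s => (1 + s) * u' s - u s) ((1 + s) * u'' s) s := fun s _ => by
    have := (((hasDerivAt_id s).const_add 1).mul (h2 s)).sub (h1 s)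
    refine this.congr_deriv ?_
    simp
  have d2 : ∀ s ∈ uIcc (0 : ℝ) 1,
      HasDerivAt (fun s => (1 - s) * u' s + u s) ((1 - s) * u'' s) s := fun s _ => by
    have := (((hasDerivAt_id s).const_sub 1).mul (h2 s)).add (h1 s)
    refine this.congr_deriv ?_
    simp
  rw [e1, e2, intervalIntegral.integral_eq_sub_of_hasDerivAt d1
    (Continuous.intervalIntegrable (by fun_prop) _ _),
    intervalIntegral.integral_eq_sub_of_hasDerivAt d2
    (Continuous.intervalIntegrable (by fun_prop) _ _)]
  norm_num
  ring

lemma integral_one_sub_abs : ∫ s in (-1 : ℝ)..1, (1 - |s|) = 1 := by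
  have h := second_difference_eq_integral (u := fun s => s ^ 2 / 2) (u' := fun s => s)
    (u'' := fun _ => 1) (fun s => by
      have := (hasDerivAt_pow 2 s).div_const 2
      refine this.congr_deriv ?_
      simp) (fun s => hasDerivAt_id s) continuous_const
  simp only [mul_one] at h
  rw [← h]
  norm_num

/-- The integrand of the potential of a stressed segment with direction `(d₁, d₂)`. -/
def kern (β B : ℝ → ℝ) (d₁ d₂ x₁ x₂ : ℝ) : ℝ :=
  d₂ ^ 2 * β x₁ + d₁ ^ 2 * β x₂ - d₁ * d₂ * (B x₁ * B x₂)

/-- The flux term arising in the second derivative of `kern`. -/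
def flux (δ B : ℝ → ℝ) (d₁ d₂ v₁ v₂ x₁ x₂ : ℝ) : ℝ :=
  d₂ * (v₁ ^ 2 * (δ x₁ * B x₂) - 2 * v₁ * v₂ * B x₁) +
    d₁ * (v₂ ^ 2 * (B x₁ * δ x₂) - 2 * v₁ * v₂ * B x₂)

/-- The potential of the segment from `0` to `(d₁, d₂)`. -/
def segPot (β B : ℝ → ℝ) (d₁ d₂ x₁ x₂ : ℝ) : ℝ :=
  ∫ t in (0 : ℝ)..1, kern β B d₁ d₂ (x₁ - t * d₁) (x₂ - t * d₂)

/-- The mollified amount by which the segment from `-v` to `v`, centred at `x`, crosses the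
segment `t ↦ t d`, `0 ≤ t ≤ τ`, modulo `ℤ²`. -/
def crossInt (m : ℕ) (τ d₁ d₂ v₁ v₂ x₁ x₂ : ℝ) : ℝ :=
  ∫ t in (0 : ℝ)..τ, ∫ s in (-1 : ℝ)..1,
    (1 - |s|) * (bump m (x₁ + s * v₁ - t * d₁) * bump m (x₂ + s * v₂ - t * d₂))

lemma segPot_second_difference (m : ℕ) (d₁ d₂ v₁ v₂ x₁ x₂ : ℝ) :
    segPot (sawInt m) (saw m) d₁ d₂ (x₁ + v₁) (x₂ + v₂)
      + segPot (sawInt m) (saw m) d₁ d₂ (x₁ - v₁) (x₂ - v₂)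
      - 2 * segPot (sawInt m) (saw m) d₁ d₂ x₁ x₂ =
    (d₂ * v₁ - d₁ * v₂) ^ 2 * crossInt m 1 d₁ d₂ v₁ v₂ x₁ x₂ - (d₂ * v₁ - d₁ * v₂) ^ 2 +
      ∫ s in (-1 : ℝ)..1, (1 - |s|) *
        (flux (bump m) (saw m) d₁ d₂ v₁ v₂ (x₁ + s * v₁ - d₁) (x₂ + s * v₂ - d₂) -
          flux (bump m) (saw m) d₁ d₂ v₁ v₂ (x₁ + s * v₁) (x₂ + s * v₂)) := by
  have c0 := bump_continuous m
  have c1 := saw_continuous m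
  have c2 := sawInt_continuous m
  have c3 : Continuous (deriv (bump m)) := (bump_contDiff m).continuous_deriv le_rfl
  have hb : ∀ x, HasDerivAt (bump m) (deriv (bump m) x) x := fun x =>
    ((bump_contDiff m).differentiable one_ne_zero x).hasDerivAt
  -- derivative of the flux along the segment
  let F : ℝ → ℝ → ℝ := fun x y =>
    d₂ * (v₁ ^ 2 * ((-d₁ * deriv (bump m) x) * saw m y + bump m x * (-d₂ * (bump m y - 1)))
      - 2 * v₁ * v₂ * (-d₁ * (bump m x - 1))) +
    d₁ * (v₂ ^ 2 * ((-d₁ * (bump m x - 1)) * bump m y + saw m x * (-d₂ * deriv (bump m) y))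
      - 2 * v₁ * v₂ * (-d₂ * (bump m y - 1)))
  have cF : Continuous fun p : ℝ × ℝ => F p.1 p.2 := by
    simp only [F]
    fun_prop
  have dlin : ∀ (a b t : ℝ), HasDerivAt (fun t => a - t * b) (-b) t := fun a b t => by
    simpa using ((hasDerivAt_id t).mul_const b).const_sub a
  have slin : ∀ (a b c s : ℝ), HasDerivAt (fun s => a + s * b - c) b s := fun a b c s => by
    simpa using (((hasDerivAt_id s).mul_const b).const_add a).sub_const c
  have hflux : ∀ y₁ y₂ t, HasDerivAt
      (fun t => flux (bump m) (saw m) d₁ d₂ v₁ v₂ (y₁ - t * d₁) (y₂ - t * d₂))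
      (F (y₁ - t * d₁) (y₂ - t * d₂)) t := fun y₁ y₂ t => by
    have b1 := (hb (y₁ - t * d₁)).comp t (dlin y₁ d₁ t)
    have b2 := (hb (y₂ - t * d₂)).comp t (dlin y₂ d₂ t)
    have s1 := (saw_hasDerivAt m (y₁ - t * d₁)).comp t (dlin y₁ d₁ t)
    have s2 := (saw_hasDerivAt m (y₂ - t * d₂)).comp t (dlin y₂ d₂ t)
    have := ((((b1.mul s2).const_mul (v₁ ^ 2)).sub (s1.const_mul (2 * v₁ * v₂))).const_mul d₂).add
      ((((s1.mul b2).const_mul (v₂ ^ 2)).sub (s2.const_mul (2 * v₁ * v₂))).const_mul d₁)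
    refine this.congr_deriv ?_
    simp only [F, Function.comp]
    ring
  have hpt : ∀ t : ℝ,
      kern (sawInt m) (saw m) d₁ d₂ (x₁ + v₁ - t * d₁) (x₂ + v₂ - t * d₂)
      + kern (sawInt m) (saw m) d₁ d₂ (x₁ - v₁ - t * d₁) (x₂ - v₂ - t * d₂)
      - 2 * kern (sawInt m) (saw m) d₁ d₂ (x₁ - t * d₁) (x₂ - t * d₂) =
      (d₂ * v₁ - d₁ * v₂) ^ 2 * (∫ s in (-1 : ℝ)..1,
        (1 - |s|) * (bump m (x₁ + s * v₁ - t * d₁) * bump m (x₂ + s * v₂ - t * d₂)))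
      - (d₂ * v₁ - d₁ * v₂) ^ 2
      + ∫ s in (-1 : ℝ)..1, (1 - |s|) * F (x₁ + s * v₁ - t * d₁) (x₂ + s * v₂ - t * d₂) := by
    intro t
    have h := second_difference_eq_integral
      (u := fun s => kern (sawInt m) (saw m) d₁ d₂ (x₁ + s * v₁ - t * d₁) (x₂ + s * v₂ - t * d₂))
      (u' := fun s => d₂ ^ 2 * (saw m (x₁ + s * v₁ - t * d₁) * v₁)
        + d₁ ^ 2 * (saw m (x₂ + s * v₂ - t * d₂) * v₂)
        - d₁ * d₂ * ((bump m (x₁ + s * v₁ - t * d₁) - 1) * v₁ * saw m (x₂ + s * v₂ - t * d₂)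
          + saw m (x₁ + s * v₁ - t * d₁) * ((bump m (x₂ + s * v₂ - t * d₂) - 1) * v₂)))
      (u'' := fun s => (d₂ * v₁ - d₁ * v₂) ^ 2 *
          (bump m (x₁ + s * v₁ - t * d₁) * bump m (x₂ + s * v₂ - t * d₂))
          - (d₂ * v₁ - d₁ * v₂) ^ 2 + F (x₁ + s * v₁ - t * d₁) (x₂ + s * v₂ - t * d₂))
      (fun s => by
        have S1 := (sawInt_hasDerivAt m _).comp s (slin x₁ v₁ (t * d₁) s)
        have S2 := (sawInt_hasDerivAt m _).comp s (slin x₂ v₂ (t * d₂) s)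
        have s1 := (saw_hasDerivAt m _).comp s (slin x₁ v₁ (t * d₁) s)
        have s2 := (saw_hasDerivAt m _).comp s (slin x₂ v₂ (t * d₂) s)
        exact ((S1.const_mul (d₂ ^ 2)).add (S2.const_mul (d₁ ^ 2))).sub
          ((s1.mul s2).const_mul (d₁ * d₂)))
      (fun s => by
        have s1 := (saw_hasDerivAt m _).comp s (slin x₁ v₁ (t * d₁) s)
        have s2 := (saw_hasDerivAt m _).comp s (slin x₂ v₂ (t * d₂) s)
        have b1 := (((hb _).comp s (slin x₁ v₁ (t * d₁) s)).sub_const 1).mul_const v₁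
        have b2 := (((hb _).comp s (slin x₂ v₂ (t * d₂) s)).sub_const 1).mul_const v₂
        have := (((s1.mul_const v₁).const_mul (d₂ ^ 2)).add
          ((s2.mul_const v₂).const_mul (d₁ ^ 2))).sub
          (((b1.mul s2).add (s1.mul b2)).const_mul (d₁ * d₂))
        refine this.congr_deriv ?_
        simp only [F, Function.comp]
        ring)
      (by
        have : Continuous fun s => F (x₁ + s * v₁ - t * d₁) (x₂ + s * v₂ - t * d₂) :=
          cF.comp (f := fun s => (x₁ + s * v₁ - t * d₁, x₂ + s * v₂ - t * d₂)) (by fun_prop)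
        fun_prop)
    simp only [one_mul, neg_one_mul, zero_mul, add_zero, ← sub_eq_add_neg] at h
    rw [h]
    have cFs : Continuous fun s => F (x₁ + s * v₁ - t * d₁) (x₂ + s * v₂ - t * d₂) :=
      cF.comp (f := fun s => (x₁ + s * v₁ - t * d₁, x₂ + s * v₂ - t * d₂)) (by fun_prop)
    have e3 : ∫ s in (-1 : ℝ)..1, (1 - |s|) * ((d₂ * v₁ - d₁ * v₂) ^ 2 *
          (bump m (x₁ + s * v₁ - t * d₁) * bump m (x₂ + s * v₂ - t * d₂))
          - (d₂ * v₁ - d₁ * v₂) ^ 2 + F (x₁ + s * v₁ - t * d₁) (x₂ + s * v₂ - t * d₂)) =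
        ∫ s in (-1 : ℝ)..1, ((d₂ * v₁ - d₁ * v₂) ^ 2 * ((1 - |s|) *
          (bump m (x₁ + s * v₁ - t * d₁) * bump m (x₂ + s * v₂ - t * d₂)))
          - (d₂ * v₁ - d₁ * v₂) ^ 2 * (1 - |s|)
          + (1 - |s|) * F (x₁ + s * v₁ - t * d₁) (x₂ + s * v₂ - t * d₂)) :=
      intervalIntegral.integral_congr fun s _ => by ring
    rw [e3, intervalIntegral.integral_add (Continuous.intervalIntegrable (by fun_prop) _ _)
      (Continuous.intervalIntegrable (by fun_prop) _ _), intervalIntegral.integral_sub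
      (Continuous.intervalIntegrable (by fun_prop) _ _)
      (Continuous.intervalIntegrable (by fun_prop) _ _), intervalIntegral.integral_const_mul,
      intervalIntegral.integral_const_mul, integral_one_sub_abs, mul_one]
  have ck : ∀ a b, Continuous fun t => kern (sawInt m) (saw m) d₁ d₂ (a - t * d₁) (b - t * d₂) :=
    fun a b => by
      unfold kern
      fun_prop
  have ck2 : Continuous fun t =>
      kern (sawInt m) (saw m) d₁ d₂ (x₁ + v₁ - t * d₁) (x₂ + v₂ - t * d₂)
      + kern (sawInt m) (saw m) d₁ d₂ (x₁ - v₁ - t * d₁) (x₂ - v₂ - t * d₂) :=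
    (ck _ _).add (ck _ _)
  have swap : ∫ t in (0 : ℝ)..1, ∫ s in (-1 : ℝ)..1,
      (1 - |s|) * F (x₁ + s * v₁ - t * d₁) (x₂ + s * v₂ - t * d₂) =
      ∫ s in (-1 : ℝ)..1, (1 - |s|) *
        (flux (bump m) (saw m) d₁ d₂ v₁ v₂ (x₁ + s * v₁ - d₁) (x₂ + s * v₂ - d₂) -
          flux (bump m) (saw m) d₁ d₂ v₁ v₂ (x₁ + s * v₁) (x₂ + s * v₂)) := by
    have cG : Continuous fun p : ℝ × ℝ =>
        (1 - |p.2|) * F (x₁ + p.2 * v₁ - p.1 * d₁) (x₂ + p.2 * v₂ - p.1 * d₂) := by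
      have := cF.comp (f := fun p : ℝ × ℝ =>
        (x₁ + p.2 * v₁ - p.1 * d₁, x₂ + p.2 * v₂ - p.1 * d₂)) (by fun_prop)
      exact (by fun_prop : Continuous fun p : ℝ × ℝ => 1 - |p.2|).mul this
    rw [intervalIntegral_intervalIntegral_swap]
    · refine intervalIntegral.integral_congr fun s _ => ?_
      simp only [intervalIntegral.integral_const_mul]
      rw [intervalIntegral.integral_eq_sub_of_hasDerivAt (fun t _ => hflux _ _ t)]
      · simp
      · exact Continuous.intervalIntegrable
          (cF.comp (f := fun t => (x₁ + s * v₁ - t * d₁, x₂ + s * v₂ - t * d₂)) (by fun_prop)) _ _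
    · refine (cG.continuousOn.integrableOn_compact
        (isCompact_uIcc.prod isCompact_uIcc)).mono_set
        (prod_mono uIoc_subset_uIcc uIoc_subset_uIcc)
  rw [← swap]
  unfold segPot crossInt
  rw [← intervalIntegral.integral_const_mul, ← intervalIntegral.integral_const_mul,
    ← intervalIntegral.integral_add ((ck _ _).intervalIntegrable _ _)
      ((ck _ _).intervalIntegrable _ _),
    ← intervalIntegral.integral_sub (ck2.intervalIntegrable _ _)
      (((ck _ _).const_mul 2).intervalIntegrable _ _)]
  have cF2 : Continuous fun t => ∫ s in (-1 : ℝ)..1,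
      (1 - |s|) * F (x₁ + s * v₁ - t * d₁) (x₂ + s * v₂ - t * d₂) := by
    apply intervalIntegral.continuous_parametric_intervalIntegral_of_continuous'
    have := cF.comp (f := fun p : ℝ × ℝ =>
        (x₁ + p.2 * v₁ - p.1 * d₁, x₂ + p.2 * v₂ - p.1 * d₂)) (by fun_prop)
    exact (by fun_prop : Continuous fun p : ℝ × ℝ => 1 - |p.2|).mul this
  have cB2 : Continuous fun t => ∫ s in (-1 : ℝ)..1,
      (1 - |s|) * (bump m (x₁ + s * v₁ - t * d₁) * bump m (x₂ + s * v₂ - t * d₂)) := by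
    apply intervalIntegral.continuous_parametric_intervalIntegral_of_continuous'
    simp only [Function.uncurry_def]
    fun_prop
  have cB3 : Continuous fun t => (d₂ * v₁ - d₁ * v₂) ^ 2 * (∫ s in (-1 : ℝ)..1,
      (1 - |s|) * (bump m (x₁ + s * v₁ - t * d₁) * bump m (x₂ + s * v₂ - t * d₂)))
      - (d₂ * v₁ - d₁ * v₂) ^ 2 := (cB2.const_mul _).sub continuous_const
  rw [intervalIntegral.integral_congr (fun t _ => hpt t), intervalIntegral.integral_add
    (cB3.intervalIntegrable _ _) (cF2.intervalIntegrable _ _), intervalIntegral.integral_sub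
    ((cB2.const_mul _).intervalIntegrable _ _) (continuous_const.intervalIntegrable _ _)]
  simp

lemma mul_saw_mul_saw_tendsto (d₁ d₂ x₁ x₂ : ℝ) :
    ∀ᵐ t : ℝ, Tendsto (fun m => d₁ * d₂ * (saw m (x₁ - t * d₁) * saw m (x₂ - t * d₂))) atTop
      (𝓝 (d₁ * d₂ * (sawLim (x₁ - t * d₁) * sawLim (x₂ - t * d₂)))) := by
  by_cases h : d₁ * d₂ = 0
  · simp [h]
  · filter_upwards [ae_forall_ne_int x₁ (left_ne_zero_of_mul h),
      ae_forall_ne_int x₂ (right_ne_zero_of_mul h)] with t h1 h2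
    exact ((saw_tendsto h1).mul (saw_tendsto h2)).const_mul _

lemma abs_kern_le {β B : ℝ → ℝ} {x₁ x₂ b : ℝ} (h1 : |β x₁| ≤ b) (h2 : |β x₂| ≤ b)
    (h3 : |B x₁| ≤ 1) (h4 : |B x₂| ≤ 1) (d₁ d₂ : ℝ) :
    |kern β B d₁ d₂ x₁ x₂| ≤ (d₁ ^ 2 + d₂ ^ 2) * b + |d₁ * d₂| := by
  unfold kern
  have e : |B x₁ * B x₂| ≤ 1 := by
    rw [abs_mul]
    exact mul_le_one₀ h3 (abs_nonneg _) h4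
  calc _ ≤ |d₂ ^ 2 * β x₁ + d₁ ^ 2 * β x₂| + |d₁ * d₂ * (B x₁ * B x₂)| := abs_sub _ _
    _ ≤ |d₂ ^ 2 * β x₁| + |d₁ ^ 2 * β x₂| + |d₁ * d₂ * (B x₁ * B x₂)| := by
      gcongr
      exact abs_add_le _ _
    _ = d₂ ^ 2 * |β x₁| + d₁ ^ 2 * |β x₂| + |d₁ * d₂| * |B x₁ * B x₂| := by
      rw [abs_mul, abs_mul, abs_mul (d₁ * d₂), abs_of_nonneg (sq_nonneg d₁),
        abs_of_nonneg (sq_nonneg d₂)]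
    _ ≤ d₂ ^ 2 * b + d₁ ^ 2 * b + |d₁ * d₂| * 1 := by gcongr
    _ = _ := by ring

lemma segPot_tendsto (d₁ d₂ x₁ x₂ : ℝ) :
    Tendsto (fun m => segPot (sawInt m) (saw m) d₁ d₂ x₁ x₂) atTop
      (𝓝 (segPot sawLimInt sawLim d₁ d₂ x₁ x₂)) := by
  unfold segPot
  refine intervalIntegral.tendsto_integral_filter_of_dominated_convergence
    (fun _ => (d₁ ^ 2 + d₂ ^ 2) * 1 + |d₁ * d₂|) (Eventually.of_forall fun m => ?_)
    (Eventually.of_forall fun m => ae_of_all _ fun t _ => ?_) (by simp) ?_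
  · have c1 := saw_continuous m
    have c2 := sawInt_continuous m
    unfold kern
    exact Continuous.aestronglyMeasurable (by fun_prop)
  · exact abs_kern_le (abs_sawInt_le m _) (abs_sawInt_le m _) (abs_saw_le m _) (abs_saw_le m _) _ _
  · filter_upwards [mul_saw_mul_saw_tendsto d₁ d₂ x₁ x₂] with t ht _
    exact (((sawInt_tendsto _).const_mul _).add ((sawInt_tendsto _).const_mul _)).sub ht

lemma abs_sawLimInt_le (x : ℝ) : |sawLimInt x| ≤ 1 :=
  le_of_tendsto (sawInt_tendsto x).abs (Eventually.of_forall fun m => abs_sawInt_le m x)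

lemma segPot_continuous (d₁ d₂ : ℝ) :
    Continuous fun x : ℝ × ℝ => segPot sawLimInt sawLim d₁ d₂ x.1 x.2 := by
  rw [continuous_iff_continuousAt]
  intro x
  unfold segPot
  refine intervalIntegral.continuousAt_of_dominated_interval
    (bound := fun _ => (d₁ ^ 2 + d₂ ^ 2) * 1 + |d₁ * d₂|) (Eventually.of_forall fun y => ?_)
    (Eventually.of_forall fun y => ae_of_all _ fun t _ => ?_) (by simp) ?_
  · have c1 := measurable_sawLim
    have c2 := sawLimInt_continuous.measurable
    unfold kern
    exact Measurable.aestronglyMeasurable (by fun_prop)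
  · exact abs_kern_le (abs_sawLimInt_le _) (abs_sawLimInt_le _) (abs_sawLim_le _)
      (abs_sawLim_le _) _ _
  · have c2 := sawLimInt_continuous
    unfold kern
    by_cases h : d₁ * d₂ = 0
    · refine ae_of_all _ fun t _ => ?_
      simp only [h, zero_mul, sub_zero]
      fun_prop
    · filter_upwards [ae_forall_ne_int x.1 (left_ne_zero_of_mul h),
        ae_forall_ne_int x.2 (right_ne_zero_of_mul h)] with t h1 h2 _
      have e1 : ContinuousAt (fun y : ℝ × ℝ => sawLim (y.1 - t * d₁)) x :=
        ContinuousAt.comp (f := fun y : ℝ × ℝ => y.1 - t * d₁) (sawLim_continuousAt h1)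
          (by fun_prop)
      have e2 : ContinuousAt (fun y : ℝ × ℝ => sawLim (y.2 - t * d₂)) x :=
        ContinuousAt.comp (f := fun y : ℝ × ℝ => y.2 - t * d₂) (sawLim_continuousAt h2)
          (by fun_prop)
      fun_prop

lemma segPot_periodic (d₁ d₂ x₁ x₂ : ℝ) (k l : ℤ) :
    segPot sawLimInt sawLim d₁ d₂ (x₁ + k) (x₂ + l) = segPot sawLimInt sawLim d₁ d₂ x₁ x₂ := by
  have hp : Function.Periodic sawLimInt 1 := fun x => by
    refine tendsto_nhds_unique (sawInt_tendsto (x + 1)) ?_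
    simp only [sawInt_add_one]
    exact sawInt_tendsto x
  have hz : ∀ (x : ℝ) (k : ℤ), sawLimInt (x + k) = sawLimInt x := fun x k => by
    simpa using hp.int_mul k x
  have hs : ∀ (x : ℝ) (k : ℤ), sawLim (x + k) = sawLim x := fun x k => by
    simp [sawLim]
  unfold segPot kern
  refine intervalIntegral.integral_congr fun t _ => ?_
  rw [show x₁ + k - t * d₁ = x₁ - t * d₁ + k by ring,
    show x₂ + l - t * d₂ = x₂ - t * d₂ + l by ring]
  simp only [hz, hs]

/-- A stressed toroidal framework whose stress has vanishing second moment lifts to a continuous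
periodic function, whose second differences are the stress-weighted crossing amounts. -/
theorem exists_periodic_lift {ι : Type*} (s : Finset ι) (ω a₁ a₂ d₁ d₂ : ι → ℝ)
    (heq : ∀ f : ℝ → ℝ → ℝ, (∀ x y, f (x + 1) y = f x y) → (∀ x y, f x (y + 1) = f x y) →
      ∑ e ∈ s, ω e * d₁ e * (f (a₁ e + d₁ e) (a₂ e + d₂ e) - f (a₁ e) (a₂ e)) = 0 ∧
      ∑ e ∈ s, ω e * d₂ e * (f (a₁ e + d₁ e) (a₂ e + d₂ e) - f (a₁ e) (a₂ e)) = 0)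
    (h11 : ∑ e ∈ s, ω e * d₁ e ^ 2 = 0) (h12 : ∑ e ∈ s, ω e * (d₁ e * d₂ e) = 0)
    (h22 : ∑ e ∈ s, ω e * d₂ e ^ 2 = 0) :
    ∃ h : ℝ → ℝ → ℝ, Continuous (fun x : ℝ × ℝ => h x.1 x.2) ∧
      (∀ x₁ x₂ (k l : ℤ), h (x₁ + k) (x₂ + l) = h x₁ x₂) ∧
      ∀ x₁ x₂ v₁ v₂, Tendsto (fun m => ∑ e ∈ s, ω e * ((d₂ e * v₁ - d₁ e * v₂) ^ 2 *
          crossInt m 1 (d₁ e) (d₂ e) v₁ v₂ (x₁ - a₁ e) (x₂ - a₂ e))) atTop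
        (𝓝 (h (x₁ + v₁) (x₂ + v₂) + h (x₁ - v₁) (x₂ - v₂) - 2 * h x₁ x₂)) := by
  refine ⟨fun x₁ x₂ => ∑ e ∈ s,
    ω e * segPot sawLimInt sawLim (d₁ e) (d₂ e) (x₁ - a₁ e) (x₂ - a₂ e), ?_, ?_, ?_⟩
  · refine continuous_finsetSum _ fun e _ => continuous_const.mul ?_
    exact (segPot_continuous (d₁ e) (d₂ e)).comp
      (f := fun x : ℝ × ℝ => (x.1 - a₁ e, x.2 - a₂ e)) (by fun_prop)
  · intro x₁ x₂ k l
    refine Finset.sum_congr rfl fun e _ => ?_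
    rw [← segPot_periodic _ _ (x₁ - a₁ e) (x₂ - a₂ e) k l]
    congr 2 <;> ring
  · intro x₁ x₂ v₁ v₂
    have key : ∀ m, ∑ e ∈ s, ω e * ((d₂ e * v₁ - d₁ e * v₂) ^ 2 *
          crossInt m 1 (d₁ e) (d₂ e) v₁ v₂ (x₁ - a₁ e) (x₂ - a₂ e)) =
        ∑ e ∈ s, ω e * segPot (sawInt m) (saw m) (d₁ e) (d₂ e) (x₁ + v₁ - a₁ e) (x₂ + v₂ - a₂ e)
        + ∑ e ∈ s, ω e * segPot (sawInt m) (saw m) (d₁ e) (d₂ e) (x₁ - v₁ - a₁ e) (x₂ - v₂ - a₂ e)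
        - 2 * ∑ e ∈ s, ω e * segPot (sawInt m) (saw m) (d₁ e) (d₂ e) (x₁ - a₁ e) (x₂ - a₂ e) := by
      intro m
      have c0 := bump_continuous m
      have c1 := saw_continuous m
      have hsq : ∑ e ∈ s, ω e * (d₂ e * v₁ - d₁ e * v₂) ^ 2 = 0 := by
        have : ∀ e ∈ s, ω e * (d₂ e * v₁ - d₁ e * v₂) ^ 2 = v₁ ^ 2 * (ω e * d₂ e ^ 2)
            - 2 * v₁ * v₂ * (ω e * (d₁ e * d₂ e)) + v₂ ^ 2 * (ω e * d₁ e ^ 2) := fun e _ => by ring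
        rw [Finset.sum_congr rfl this, Finset.sum_add_distrib, Finset.sum_sub_distrib,
          ← Finset.mul_sum, ← Finset.mul_sum, ← Finset.mul_sum, h11, h12, h22]
        ring
      have hflux : ∑ e ∈ s, ω e * (∫ t in (-1 : ℝ)..1, (1 - |t|) *
          (flux (bump m) (saw m) (d₁ e) (d₂ e) v₁ v₂
            (x₁ - a₁ e + t * v₁ - d₁ e) (x₂ - a₂ e + t * v₂ - d₂ e) -
          flux (bump m) (saw m) (d₁ e) (d₂ e) v₁ v₂
            (x₁ - a₁ e + t * v₁) (x₂ - a₂ e + t * v₂))) = 0 := by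
        simp only [← intervalIntegral.integral_const_mul]
        rw [← intervalIntegral.integral_finsetSum]
        · rw [← intervalIntegral.integral_zero (a := -1) (b := 1) (μ := volume)]
          refine intervalIntegral.integral_congr fun t _ => ?_
          have p1 := (heq (fun y₁ y₂ => v₂ ^ 2 * (saw m (x₁ + t * v₁ - y₁) *
              bump m (x₂ + t * v₂ - y₂)) - 2 * v₁ * v₂ * saw m (x₂ + t * v₂ - y₂))
            (fun x y => by
              rw [← saw_add_one m (x₁ + t * v₁ - (x + 1)), sub_add_eq_sub_sub, sub_add_cancel])
            (fun x y => by
              rw [← saw_add_one m (x₂ + t * v₂ - (y + 1)), ← bump_add_one m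
                (x₂ + t * v₂ - (y + 1)), sub_add_eq_sub_sub, sub_add_cancel])).1
          have p2 := (heq (fun y₁ y₂ => v₁ ^ 2 * (bump m (x₁ + t * v₁ - y₁) *
              saw m (x₂ + t * v₂ - y₂)) - 2 * v₁ * v₂ * saw m (x₁ + t * v₁ - y₁))
            (fun x y => by
              rw [← saw_add_one m (x₁ + t * v₁ - (x + 1)), ← bump_add_one m
                (x₁ + t * v₁ - (x + 1)), sub_add_eq_sub_sub, sub_add_cancel])
            (fun x y => by
              rw [← saw_add_one m (x₂ + t * v₂ - (y + 1)), sub_add_eq_sub_sub,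
                sub_add_cancel])).2
          have p3 := congrArg (fun z => (1 - |t|) * z) (congrArg₂ (· + ·) p1 p2)
          simp only [add_zero, mul_zero, ← Finset.sum_add_distrib, Finset.mul_sum] at p3
          rw [← p3]
          refine Finset.sum_congr rfl fun e _ => ?_
          unfold flux
          rw [show x₁ - a₁ e + t * v₁ - d₁ e = x₁ + t * v₁ - (a₁ e + d₁ e) by ring,
            show x₂ - a₂ e + t * v₂ - d₂ e = x₂ + t * v₂ - (a₂ e + d₂ e) by ring,
            show x₁ - a₁ e + t * v₁ = x₁ + t * v₁ - a₁ e by ring,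
            show x₂ - a₂ e + t * v₂ = x₂ + t * v₂ - a₂ e by ring]
          ring
        · intro e _
          unfold flux
          exact Continuous.intervalIntegrable (by fun_prop) _ _
      have hsum := Finset.sum_congr rfl fun e (_ : e ∈ s) => congrArg (fun z => ω e * z)
        (segPot_second_difference m (d₁ e) (d₂ e) v₁ v₂ (x₁ - a₁ e) (x₂ - a₂ e))
      simp only [mul_add, mul_sub, Finset.sum_add_distrib, Finset.sum_sub_distrib] at hsum
      simp only [← mul_sub] at hsum
      rw [hflux, hsq] at hsum
      rw [sub_zero, add_zero] at hsum
      rw [← hsum, Finset.mul_sum]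
      congr 1
      · congr 1
        · refine Finset.sum_congr rfl fun e _ => ?_
          congr 2 <;> ring
        · refine Finset.sum_congr rfl fun e _ => ?_
          congr 2 <;> ring
      · refine Finset.sum_congr rfl fun e _ => ?_
        ring
    simp only [key]
    exact ((tendsto_finsetSum _ fun e _ => (segPot_tendsto _ _ _ _).const_mul _).add
      (tendsto_finsetSum _ fun e _ => (segPot_tendsto _ _ _ _).const_mul _)).sub
      ((tendsto_finsetSum _ fun e _ => (segPot_tendsto _ _ _ _).const_mul _).const_mul 2)

lemma bump_sub_int (m : ℕ) (x : ℝ) (k : ℤ) : bump m (x - k) = bump m x := by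
  have := (bump_periodic m).sub_int_mul_eq (x := x) k
  rwa [mul_one] at this

lemma crossInt_sub_int (m : ℕ) (τ d₁ d₂ v₁ v₂ x₁ x₂ : ℝ) (k l : ℤ) :
    crossInt m τ d₁ d₂ v₁ v₂ (x₁ - k) (x₂ - l) = crossInt m τ d₁ d₂ v₁ v₂ x₁ x₂ := by
  unfold crossInt
  simp only [show ∀ s t : ℝ, x₁ - k + s * v₁ - t * d₁ = x₁ + s * v₁ - t * d₁ - k by intros; ring,
    show ∀ s t : ℝ, x₂ - l + s * v₂ - t * d₂ = x₂ + s * v₂ - t * d₂ - l by intros; ring,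
    bump_sub_int]

lemma crossInt_inner_continuous (m : ℕ) (d₁ d₂ v₁ v₂ x₁ x₂ : ℝ) :
    Continuous fun t => ∫ s in (-1 : ℝ)..1,
      (1 - |s|) * (bump m (x₁ + s * v₁ - t * d₁) * bump m (x₂ + s * v₂ - t * d₂)) := by
  have c0 := bump_continuous m
  apply intervalIntegral.continuous_parametric_intervalIntegral_of_continuous'
  simp only [Function.uncurry_def]
  fun_prop

lemma crossInt_split (m : ℕ) (τ d₁ d₂ v₁ v₂ x₁ x₂ : ℝ) :
    crossInt m 1 d₁ d₂ v₁ v₂ x₁ x₂ = crossInt m τ d₁ d₂ v₁ v₂ x₁ x₂ +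
      crossInt m (1 - τ) (-d₁) (-d₂) v₁ v₂ (x₁ - d₁) (x₂ - d₂) := by
  have c := crossInt_inner_continuous m d₁ d₂ v₁ v₂ x₁ x₂
  unfold crossInt
  rw [← intervalIntegral.integral_add_adjacent_intervals (c.intervalIntegrable 0 τ)
    (c.intervalIntegrable τ 1)]
  congr 1
  have h := intervalIntegral.integral_comp_sub_left (a := 0) (b := 1 - τ) (fun t =>
    ∫ s in (-1 : ℝ)..1,
      (1 - |s|) * (bump m (x₁ + s * v₁ - t * d₁) * bump m (x₂ + s * v₂ - t * d₂))) 1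
  rw [sub_zero, sub_sub_cancel] at h
  rw [← h]
  refine intervalIntegral.integral_congr fun t _ => ?_
  refine intervalIntegral.integral_congr fun s _ => ?_
  congr 3 <;> ring

/-- A function vanishing exactly on the integers. -/
def intGap (x : ℝ) : ℝ := 1 - Real.cos (2 * π * x)

lemma intGap_continuous : Continuous intGap := by unfold intGap; fun_prop

lemma intGap_nonneg (x : ℝ) : 0 ≤ intGap x := by
  unfold intGap
  linarith [Real.cos_le_one (2 * π * x)]

lemma intGap_eq_zero {x : ℝ} (h : intGap x = 0) : ∃ k : ℤ, x = k := by
  have : Real.cos (2 * π * x) = 1 := by unfold intGap at h; linarith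
  obtain ⟨k, hk⟩ := (Real.cos_eq_one_iff _).1 this
  refine ⟨k, ?_⟩
  have := Real.pi_pos
  field_simp at hk
  linarith

lemma eventually_bump_mul_bump_eq_zero {α : Type*} [TopologicalSpace α] {K : Set α}
    (hK : IsCompact K) {f g : α → ℝ} (hf : Continuous f) (hg : Continuous g)
    (h : ∀ p ∈ K, ∀ k l : ℤ, f p = k → g p = l → False) :
    ∀ᶠ m in atTop, ∀ p ∈ K, bump m (f p) * bump m (g p) = 0 := by
  have hlim : Tendsto (fun m : ℕ => 2 / ((m : ℝ) + 2)) atTop (𝓝 0) := by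
    have := ((tendsto_one_div_add_atTop_nhds_zero_nat (𝕜 := ℝ)).comp
      (tendsto_add_atTop_nat 1)).const_mul 2
    rw [mul_zero] at this
    refine this.congr fun m => ?_
    simp only [Function.comp]
    push_cast
    ring
  rcases K.eq_empty_or_nonempty with rfl | hne
  · simp
  obtain ⟨p₀, hp₀, hmin⟩ := hK.exists_isMinOn hne
    (((intGap_continuous.comp hf).add (intGap_continuous.comp hg)).continuousOn)
  have hpos : 0 < intGap (f p₀) + intGap (g p₀) := by
    refine lt_of_le_of_ne (add_nonneg (intGap_nonneg _) (intGap_nonneg _)) fun h0 => ?_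
    obtain ⟨k, hk⟩ := intGap_eq_zero (x := f p₀)
      (by linarith [intGap_nonneg (f p₀), intGap_nonneg (g p₀)])
    obtain ⟨l, hl⟩ := intGap_eq_zero (x := g p₀)
      (by linarith [intGap_nonneg (f p₀), intGap_nonneg (g p₀)])
    exact h p₀ hp₀ k l hk hl
  filter_upwards [hlim.eventually_lt_const hpos] with m hm p hp
  by_contra hne
  have h1 := bump_ne_zero (left_ne_zero_of_mul hne)
  have h2 := bump_ne_zero (right_ne_zero_of_mul hne)
  have h3 : intGap (f p₀) + intGap (g p₀) ≤ intGap (f p) + intGap (g p) := hmin hp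
  have h4 : intGap (f p) + intGap (g p) < 2 / ((m : ℝ) + 2) := by
    rw [show (2 : ℝ) / ((m : ℝ) + 2) = 1 / ((m : ℝ) + 2) + 1 / ((m : ℝ) + 2) by ring]
    exact add_lt_add h1 h2
  linarith

lemma crossInt_tendsto_zero {τ d₁ d₂ v₁ v₂ x₁ x₂ : ℝ} (hτ : 0 ≤ τ)
    (h : ∀ t ∈ Icc 0 τ, ∀ s ∈ Icc (-1 : ℝ) 1, ∀ k l : ℤ,
      x₁ + s * v₁ - t * d₁ = k → x₂ + s * v₂ - t * d₂ = l → False) :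
    Tendsto (fun m => crossInt m τ d₁ d₂ v₁ v₂ x₁ x₂) atTop (𝓝 0) := by
  refine tendsto_const_nhds.congr' ?_
  filter_upwards [eventually_bump_mul_bump_eq_zero
    ((isCompact_Icc (a := 0) (b := τ)).prod (isCompact_Icc (a := (-1 : ℝ)) (b := 1)))
    (f := fun p => x₁ + p.2 * v₁ - p.1 * d₁) (g := fun p => x₂ + p.2 * v₂ - p.1 * d₂)
    (by fun_prop) (by fun_prop) (fun p hp => h p.1 hp.1 p.2 hp.2)] with m hm
  unfold crossInt
  rw [intervalIntegral.integral_congr (g := fun _ => (0 : ℝ)), intervalIntegral.integral_zero]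
  intro t ht
  rw [uIcc_of_le hτ] at ht
  simp only
  rw [intervalIntegral.integral_congr (g := fun _ => (0 : ℝ)), intervalIntegral.integral_zero]
  intro s hs
  rw [uIcc_of_le (by norm_num)] at hs
  simp only
  rw [hm (t, s) ⟨ht, hs⟩, mul_zero]

lemma bump_integral_tendsto {ε : ℝ} (h0 : 0 < ε) (h1 : ε ≤ 1 / 2) :
    Tendsto (fun m => ∫ x in -ε..ε, bump m x) atTop (𝓝 1) := by
  have h := ((saw_tendsto_of_mem_half h0 h1).add_const ε).const_mul 2
  rw [show 2 * (1 / 2 - ε + ε) = 1 by ring] at h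
  refine h.congr fun m => ?_
  rw [← intervalIntegral.integral_add_adjacent_intervals (bump_intervalIntegrable m (-ε) 0)
    (bump_intervalIntegrable m 0 ε)]
  have h2 := intervalIntegral.integral_comp_neg (fun y => bump m y) (a := 0) (b := ε)
  simp only [bump_neg, neg_zero] at h2
  rw [← h2]
  unfold saw
  ring

/-- The crossing amount of the segment from `-v` to `v` with the segment from `-τ d` to `τ d`. -/
def crossIntSym (m : ℕ) (τ d₁ d₂ v₁ v₂ : ℝ) : ℝ :=
  ∫ t in -τ..τ, ∫ s in (-1 : ℝ)..1,
    (1 - |s|) * (bump m (s * v₁ - t * d₁) * bump m (s * v₂ - t * d₂))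

lemma crossIntSym_tendsto {τ d₁ d₂ v₁ v₂ : ℝ} (hτ : 0 < τ) (hdet : d₂ * v₁ - d₁ * v₂ ≠ 0)
    (h : ∀ t ∈ Icc (-τ) τ, ∀ s ∈ Icc (-1 : ℝ) 1, ∀ k l : ℤ,
      s * v₁ - t * d₁ = k → s * v₂ - t * d₂ = l → k = 0 ∧ l = 0) :
    Tendsto (fun m => crossIntSym m τ d₁ d₂ v₁ v₂) atTop (𝓝 |d₂ * v₁ - d₁ * v₂|⁻¹) := by
  set D := d₂ * v₁ - d₁ * v₂ with hD
  have hDpos : 0 < |D| := abs_pos.2 hdet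
  let K : Set (ℝ × ℝ) := Icc (-τ) τ ×ˢ Icc (-1 : ℝ) 1
  have hKc : IsCompact K := isCompact_Icc.prod isCompact_Icc
  let T : ℝ × ℝ → ℝ × ℝ := fun p => (p.2 * v₁ - p.1 * d₁, p.2 * v₂ - p.1 * d₂)
  have hTc : Continuous T := by simp only [T]; fun_prop
  let φ : ℕ → ℝ × ℝ → ℝ := fun m p => |D| * (bump m (T p).1 * bump m (T p).2)
  have hφc : ∀ m, Continuous (φ m) := fun m => by
    have := bump_continuous m
    simp only [φ]
    fun_prop
  let S := |d₁| + |d₂| + |v₁| + |v₂| + 1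
  have hS : 0 < S := by positivity
  obtain ⟨ε, hε0, hε1, hε2⟩ : ∃ ε : ℝ, 0 < ε ∧ ε ≤ 1 / 2 ∧ S * ε ≤ |D| * min 1 τ := by
    refine ⟨min (1 / 2) (|D| * min 1 τ / S), lt_min (by norm_num) ?_, min_le_left _ _, ?_⟩
    · exact div_pos (mul_pos hDpos (lt_min one_pos hτ)) hS
    · calc S * min (1 / 2) (|D| * min 1 τ / S) ≤ S * (|D| * min 1 τ / S) := by
            gcongr; exact min_le_right _ _
        _ = _ := by field_simp
  let Q : Set (ℝ × ℝ) := Icc (-ε) ε ×ˢ Icc (-ε) ε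
  have hQm : MeasurableSet Q := measurableSet_Icc.prod measurableSet_Icc
  have hQK : T ⁻¹' Q ⊆ K := by
    rintro ⟨t, s⟩ ⟨hz1, hz2⟩
    have hz1' : |s * v₁ - t * d₁| ≤ ε := abs_le.2 hz1
    have hz2' : |s * v₂ - t * d₂| ≤ ε := abs_le.2 hz2
    have es : s * D = d₂ * (s * v₁ - t * d₁) - d₁ * (s * v₂ - t * d₂) := by rw [hD]; ring
    have et : t * D = v₂ * (s * v₁ - t * d₁) - v₁ * (s * v₂ - t * d₂) := by rw [hD]; ring
    have hgen : ∀ a b : ℝ, |a| + |b| ≤ S →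
        |a * (s * v₁ - t * d₁) - b * (s * v₂ - t * d₂)| ≤ |D| * min 1 τ := by
      intro a b hab
      calc _ ≤ |a * (s * v₁ - t * d₁)| + |b * (s * v₂ - t * d₂)| := abs_sub _ _
        _ = |a| * |s * v₁ - t * d₁| + |b| * |s * v₂ - t * d₂| := by rw [abs_mul, abs_mul]
        _ ≤ |a| * ε + |b| * ε := by gcongr
        _ = (|a| + |b|) * ε := by ring
        _ ≤ S * ε := by gcongr
        _ ≤ _ := hε2
    have a1 : |s| ≤ min 1 τ := by
      have := hgen d₂ d₁ (by simp only [S]; linarith [abs_nonneg v₁, abs_nonneg v₂])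
      rw [← es, abs_mul, mul_comm] at this
      exact le_of_mul_le_mul_left this hDpos
    have a2 : |t| ≤ min 1 τ := by
      have := hgen v₂ v₁ (by simp only [S]; linarith [abs_nonneg d₁, abs_nonneg d₂])
      rw [← et, abs_mul, mul_comm] at this
      exact le_of_mul_le_mul_left this hDpos
    exact ⟨abs_le.1 (a2.trans (min_le_right _ _)), abs_le.1 (a1.trans (min_le_left _ _))⟩
  have hpeak := tendsto_setIntegral_peak_smul_of_integrableOn_of_tendsto (μ := volume)
    (s := K) (t := T ⁻¹' Q) (φ := φ) (l := atTop) (g := fun p => 1 - |p.2|) (x₀ := (0, 0)) (a := 1)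
    (measurableSet_Icc.prod measurableSet_Icc) (hTc.measurable hQm) hQK
    (by
      refine mem_nhdsWithin_of_mem_nhds (hTc.continuousAt.preimage_mem_nhds ?_)
      have e0 : T (0, 0) = (0, 0) := by simp [T]
      rw [e0]
      exact prod_mem_nhds (Icc_mem_nhds (by linarith) hε0) (Icc_mem_nhds (by linarith) hε0))
    ((measure_mono hQK).trans_lt hKc.measure_lt_top).ne
    (Eventually.of_forall fun m p _ => mul_nonneg hDpos.le
      (mul_nonneg (bump_nonneg _ _) (bump_nonneg _ _)))
    (by
      intro u hu h0
      have hev := eventually_bump_mul_bump_eq_zero (hKc.diff hu)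
        (f := fun p => (T p).1) (g := fun p => (T p).2) (by fun_prop) (by fun_prop)
        (by
          rintro ⟨t, s⟩ ⟨hp, hpu⟩ k l hk hl
          obtain ⟨rfl, rfl⟩ := h t hp.1 s hp.2 k l hk hl
          simp only [Int.cast_zero, T] at hk hl
          have es : s * D = d₂ * (s * v₁ - t * d₁) - d₁ * (s * v₂ - t * d₂) := by rw [hD]; ring
          have et : t * D = v₂ * (s * v₁ - t * d₁) - v₁ * (s * v₂ - t * d₂) := by rw [hD]; ring
          rw [hk, hl, mul_zero, mul_zero, sub_zero] at es et
          have s0 : s = 0 := (mul_eq_zero.1 es).resolve_right hdet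
          have t0 : t = 0 := (mul_eq_zero.1 et).resolve_right hdet
          rw [s0, t0] at hpu
          exact hpu h0)
      rw [Metric.tendstoUniformlyOn_iff]
      intro δ hδ
      filter_upwards [hev] with m hm p hp
      simp only [φ, hm p hp, mul_zero, Pi.zero_apply, dist_self]
      exact hδ)
    (by
      have hlin := Matrix.toLin_finTwoProd_apply (-d₁) v₁ (-d₂) v₂
      set L := Matrix.toLin (Module.Basis.finTwoProd ℝ) (Module.Basis.finTwoProd ℝ)
        !![-d₁, v₁; -d₂, v₂] with hL
      have hLT : ∀ p, L p = T p := fun p => by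
        rw [hlin]
        ext <;> simp only [T] <;> ring
      have hLdet : LinearMap.det L = D := by
        rw [hL, LinearMap.det_toLin, Matrix.det_fin_two_of, hD]
        ring
      have hmap := Measure.map_linearMap_addHaar_eq_smul_addHaar (volume : Measure (ℝ × ℝ))
        (f := L) (by rwa [hLdet])
      rw [show (L : ℝ × ℝ → ℝ × ℝ) = T from funext hLT, hLdet] at hmap
      have h_int : ∀ m, ∫ p in T ⁻¹' Q, φ m p =
          (∫ x in -ε..ε, bump m x) * ∫ x in -ε..ε, bump m x := by
        intro m
        have c0 := bump_continuous m
        have h1 := setIntegral_map (μ := (volume : Measure (ℝ × ℝ))) (g := T)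
          (f := fun z : ℝ × ℝ => bump m z.1 * bump m z.2) hQm
          (Continuous.aestronglyMeasurable (by fun_prop)) hTc.aemeasurable
        simp only [φ]
        rw [integral_const_mul, ← h1, hmap, Measure.restrict_smul, integral_smul_measure,
          ENNReal.toReal_ofReal (abs_nonneg _), abs_inv, smul_eq_mul, ← mul_assoc,
          mul_inv_cancel₀ hDpos.ne', one_mul, Measure.volume_eq_prod,
          setIntegral_prod_mul (bump m) (bump m),
          integral_Icc_eq_integral_Ioc, intervalIntegral.integral_of_le (by linarith)]
      simp only [h_int]
      simpa using (bump_integral_tendsto hε0 hε1).mul (bump_integral_tendsto hε0 hε1))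
    (Eventually.of_forall fun m => (hφc m).aestronglyMeasurable)
    (Continuous.continuousOn (by fun_prop) |>.integrableOn_compact hKc)
    (by
      have : Continuous fun p : ℝ × ℝ => 1 - |p.2| := by fun_prop
      have h2 := this.tendsto (0, 0)
      simp only [abs_zero, sub_zero] at h2
      exact h2.mono_left nhdsWithin_le_nhds)
  have hres := hpeak.const_mul (|D|⁻¹)
  rw [mul_one] at hres
  refine hres.congr fun m => ?_
  have c0 := bump_continuous m
  unfold crossIntSym
  rw [← integral_const_mul, Measure.volume_eq_prod, setIntegral_prod]
  · rw [intervalIntegral.integral_of_le (by linarith), integral_Icc_eq_integral_Ioc]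
    refine setIntegral_congr_fun measurableSet_Ioc fun t _ => ?_
    simp only
    rw [intervalIntegral.integral_of_le (by norm_num), integral_Icc_eq_integral_Ioc]
    refine setIntegral_congr_fun measurableSet_Ioc fun s _ => ?_
    simp only [φ, T, smul_eq_mul]
    field_simp
  · refine ContinuousOn.integrableOn_compact hKc (Continuous.continuousOn ?_)
    have := hφc m
    fun_prop

lemma crossInt_midpoint (m : ℕ) (τ d₁ d₂ v₁ v₂ : ℝ) :
    crossInt m τ d₁ d₂ v₁ v₂ (τ / 2 * d₁) (τ / 2 * d₂) = crossIntSym m (τ / 2) d₁ d₂ v₁ v₂ := by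
  unfold crossInt crossIntSym
  have h := intervalIntegral.integral_comp_sub_right (a := 0) (b := τ) (fun t =>
    ∫ s in (-1 : ℝ)..1,
      (1 - |s|) * (bump m (s * v₁ - t * d₁) * bump m (s * v₂ - t * d₂))) (τ / 2)
  rw [zero_sub, show τ - τ / 2 = τ / 2 by ring] at h
  rw [← h]
  refine intervalIntegral.integral_congr fun t _ => ?_
  refine intervalIntegral.integral_congr fun s _ => ?_
  congr 3 <;> ring

lemma crossInt_vertex (m : ℕ) (τ d₁ d₂ v₁ v₂ : ℝ) :
    crossInt m τ d₁ d₂ v₁ v₂ 0 0 = crossIntSym m τ d₁ d₂ v₁ v₂ / 2 := by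
  unfold crossInt crossIntSym
  have c := crossInt_inner_continuous m d₁ d₂ v₁ v₂ 0 0
  simp only [zero_add] at c ⊢
  rw [← intervalIntegral.integral_add_adjacent_intervals (c.intervalIntegrable (-τ) 0)
    (c.intervalIntegrable 0 τ)]
  have h := intervalIntegral.integral_comp_neg (a := 0) (b := τ) (fun t =>
    ∫ s in (-1 : ℝ)..1,
      (1 - |s|) * (bump m (s * v₁ - t * d₁) * bump m (s * v₂ - t * d₂)))
  rw [neg_zero] at h
  have h2 : ∀ t, (∫ s in (-1 : ℝ)..1,
      (1 - |s|) * (bump m (s * v₁ - -t * d₁) * bump m (s * v₂ - -t * d₂))) =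
      ∫ s in (-1 : ℝ)..1, (1 - |s|) * (bump m (s * v₁ - t * d₁) * bump m (s * v₂ - t * d₂)) := by
    intro t
    have h3 := intervalIntegral.integral_comp_neg (a := -1) (b := 1) (fun s =>
      (1 - |s|) * (bump m (s * v₁ - -t * d₁) * bump m (s * v₂ - -t * d₂)))
    rw [neg_neg] at h3
    rw [← h3]
    refine intervalIntegral.integral_congr fun s _ => ?_
    simp only [abs_neg]
    rw [show -s * v₁ - -t * d₁ = -(s * v₁ - t * d₁) by ring,
      show -s * v₂ - -t * d₂ = -(s * v₂ - t * d₂) by ring, bump_neg, bump_neg]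
  simp only [h2] at h
  rw [← h]
  ring

@[simp] lemma vec_zero (x y : ℝ) : vec x y 0 = x := rfl

@[simp] lemma vec_one (x y : ℝ) : vec x y 1 = y := rfl

lemma lvec_zero_apply (a b : ℝ) (z : ℤ × ℤ) : lvec a b z 0 = z.1 * a + z.2 * b := by
  simp [lvec]

lemma lvec_one_apply (a b : ℝ) (z : ℤ × ℤ) : lvec a b z 1 = z.2 * (1 / a) := by
  simp [lvec]

lemma lvec_neg (a b : ℝ) (z : ℤ × ℤ) : lvec a b (-z) = -lvec a b z := by
  simp only [lvec, Prod.fst_neg, Prod.snd_neg, Int.cast_neg, neg_smul]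
  abel

lemma lvec_sub (a b : ℝ) (z w : ℤ × ℤ) : lvec a b (z - w) = lvec a b z - lvec a b w := by
  simp only [lvec, Prod.fst_sub, Prod.snd_sub, Int.cast_sub, sub_smul]
  abel

lemma lvec_mem_latAB (a b : ℝ) (z : ℤ × ℤ) : lvec a b z ∈ latAB a b := ⟨z.1, z.2, rfl⟩

/-- First coordinate in the basis `(a, 0), (b, 1/a)`. -/
def fr₁ (a b : ℝ) (x : Pt) : ℝ := x 0 / a - b * x 1

/-- Second coordinate in the basis `(a, 0), (b, 1/a)`. -/
def fr₂ (a : ℝ) (x : Pt) : ℝ := a * x 1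

lemma fr₁_continuous (a b : ℝ) : Continuous (fr₁ a b) := by unfold fr₁; fun_prop

lemma fr₂_continuous (a : ℝ) : Continuous (fr₂ a) := by unfold fr₂; fun_prop

lemma fr₁_add (a b : ℝ) (x y : Pt) : fr₁ a b (x + y) = fr₁ a b x + fr₁ a b y := by
  simp only [fr₁, PiLp.add_apply]; ring

lemma fr₂_add (a : ℝ) (x y : Pt) : fr₂ a (x + y) = fr₂ a x + fr₂ a y := by
  simp only [fr₂, PiLp.add_apply]; ring

lemma fr₁_sub (a b : ℝ) (x y : Pt) : fr₁ a b (x - y) = fr₁ a b x - fr₁ a b y := by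
  simp only [fr₁, PiLp.sub_apply]; ring

lemma fr₂_sub (a : ℝ) (x y : Pt) : fr₂ a (x - y) = fr₂ a x - fr₂ a y := by
  simp only [fr₂, PiLp.sub_apply]; ring

lemma fr₁_smul (a b c : ℝ) (x : Pt) : fr₁ a b (c • x) = c * fr₁ a b x := by
  simp only [fr₁, PiLp.smul_apply, smul_eq_mul]; ring

lemma fr₂_smul (a c : ℝ) (x : Pt) : fr₂ a (c • x) = c * fr₂ a x := by
  simp only [fr₂, PiLp.smul_apply, smul_eq_mul]; ring

lemma fr₁_lvec {a : ℝ} (ha : 0 < a) (b : ℝ) (z : ℤ × ℤ) : fr₁ a b (lvec a b z) = z.1 := by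
  rw [fr₁, lvec_zero_apply, lvec_one_apply]
  field_simp
  ring

lemma fr₂_lvec {a : ℝ} (ha : 0 < a) (b : ℝ) (z : ℤ × ℤ) : fr₂ a (lvec a b z) = z.2 := by
  rw [fr₂, lvec_one_apply]
  field_simp

lemma eq_lvec_of_fr {a b : ℝ} (ha : 0 < a) {x : Pt} {k l : ℤ} (h₁ : fr₁ a b x = k)
    (h₂ : fr₂ a x = l) : x = lvec a b (k, l) := by
  have e1 : x 1 = l * (1 / a) := by
    rw [← h₂, fr₂]
    field_simp
  have e0 : x 0 = k * a + l * b := by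
    rw [← h₁, ← h₂, fr₁, fr₂]
    field_simp
    ring
  ext i
  fin_cases i
  · exact e0.trans (lvec_zero_apply a b (k, l)).symm
  · exact e1.trans (lvec_one_apply a b (k, l)).symm

lemma lvec_eq_zero {a b : ℝ} (ha : 0 < a) {z : ℤ × ℤ} (h : lvec a b z = 0) : z = 0 := by
  have h1 := fr₁_lvec ha b z
  have h2 := fr₂_lvec ha b z
  rw [h] at h1 h2
  simp only [fr₁, fr₂, PiLp.zero_apply, zero_div, mul_zero, sub_zero] at h1 h2
  exact Prod.ext (by exact_mod_cast h1.symm) (by exact_mod_cast h2.symm)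

lemma fr_det {a : ℝ} (ha : 0 < a) (b : ℝ) (D v : Pt) :
    fr₂ a D * fr₁ a b v - fr₁ a b D * fr₂ a v = -det2 D v := by
  simp only [fr₁, fr₂, det2]
  field_simp
  ring

lemma isOpen_compl_lattice {a : ℝ} (ha : 0 < a) (b : ℝ) :
    IsOpen {x : Pt | ∀ z, x ≠ lvec a b z} := by
  have : {x : Pt | ∀ z, x ≠ lvec a b z} = {x | intGap (fr₁ a b x) + intGap (fr₂ a x) ≠ 0} := by
    ext x
    constructor
    · intro h h0
      obtain ⟨k, hk⟩ := intGap_eq_zero (x := fr₁ a b x)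
        (by linarith [intGap_nonneg (fr₁ a b x), intGap_nonneg (fr₂ a x)])
      obtain ⟨l, hl⟩ := intGap_eq_zero (x := fr₂ a x)
        (by linarith [intGap_nonneg (fr₁ a b x), intGap_nonneg (fr₂ a x)])
      exact h _ (eq_lvec_of_fr ha hk hl)
    · rintro h z rfl
      apply h
      rw [fr₁_lvec ha, fr₂_lvec ha]
      have hz : ∀ k : ℤ, intGap k = 0 := fun k => by
        rw [intGap, mul_comm, Real.cos_int_mul_two_pi, sub_self]
      rw [hz, hz, add_zero]
  rw [this]
  exact isOpen_ne_fun ((intGap_continuous.comp (fr₁_continuous a b)).add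
    (intGap_continuous.comp (fr₂_continuous a))) continuous_const

lemma eventually_avoid {a b : ℝ} (ha : 0 < a) {x D : Pt} (w : Pt) {τ : ℝ}
    (h : ∀ t ∈ Icc 0 τ, ∀ z, x - t • D ≠ lvec a b z) :
    ∀ᶠ δ in 𝓝 (0 : ℝ), ∀ t ∈ Icc 0 τ, ∀ z, x + δ • w - t • D ≠ lvec a b z := by
  refine (isCompact_Icc (a := 0) (b := τ)).eventually_forall_of_forall_eventually fun t ht => ?_
  have hc : Continuous fun q : ℝ × ℝ => x + q.1 • w - q.2 • D := by fun_prop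
  refine hc.continuousAt.preimage_mem_nhds ((isOpen_compl_lattice ha b).mem_nhds ?_)
  simpa using h t ht

/-- The mollified amount by which the segment from `-v` to `v`, centred at `x`, crosses the
segment `t ↦ t D`, `0 ≤ t ≤ τ`, modulo `Λ(a, b)`. -/
def spokeInt (a b : ℝ) (m : ℕ) (τ : ℝ) (D v x : Pt) : ℝ :=
  crossInt m τ (fr₁ a b D) (fr₂ a D) (fr₁ a b v) (fr₂ a v) (fr₁ a b x) (fr₂ a x)

lemma spokeInt_tendsto_zero {a b τ : ℝ} (ha : 0 < a) (hτ : 0 ≤ τ) {D v x : Pt}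
    (h : ∀ t ∈ Icc 0 τ, ∀ s ∈ Icc (-1 : ℝ) 1, ∀ z, x + s • v - t • D ≠ lvec a b z) :
    Tendsto (fun m => spokeInt a b m τ D v x) atTop (𝓝 0) := by
  refine crossInt_tendsto_zero hτ fun t ht s hs k l hk hl => h t ht s hs (k, l) ?_
  refine eq_lvec_of_fr ha ?_ ?_
  · rw [fr₁_sub, fr₁_add, fr₁_smul, fr₁_smul, hk]
  · rw [fr₂_sub, fr₂_add, fr₂_smul, fr₂_smul, hl]

lemma crossIntSym_fr_tendsto {a b τ : ℝ} (ha : 0 < a) (hτ : 0 < τ) {D v : Pt}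
    (hdet : det2 D v ≠ 0)
    (h : ∀ t ∈ Icc (-τ) τ, ∀ s ∈ Icc (-1 : ℝ) 1, ∀ z, s • v - t • D = lvec a b z → z = 0) :
    Tendsto (fun m => crossIntSym m τ (fr₁ a b D) (fr₂ a D) (fr₁ a b v) (fr₂ a v)) atTop
      (𝓝 |det2 D v|⁻¹) := by
  have := crossIntSym_tendsto (d₁ := fr₁ a b D) (d₂ := fr₂ a D) (v₁ := fr₁ a b v) (v₂ := fr₂ a v)
    hτ (by rw [fr_det ha]; exact neg_ne_zero.2 hdet)
    (fun t ht s hs k l hk hl => by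
      have := h t ht s hs (k, l) (eq_lvec_of_fr ha
        (by rw [fr₁_sub, fr₁_smul, fr₁_smul, hk]) (by rw [fr₂_sub, fr₂_smul, fr₂_smul, hl]))
      exact Prod.mk.inj this)
  rwa [fr_det ha, abs_neg] at this

lemma spokeInt_vertex_tendsto {a b τ : ℝ} (ha : 0 < a) (hτ : 0 < τ) {D v : Pt}
    (hdet : det2 D v ≠ 0)
    (h : ∀ t ∈ Icc (-τ) τ, ∀ s ∈ Icc (-1 : ℝ) 1, ∀ z, s • v - t • D = lvec a b z → z = 0) :
    Tendsto (fun m => spokeInt a b m τ D v 0) atTop (𝓝 (|det2 D v|⁻¹ / 2)) := by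
  have e1 : fr₁ a b 0 = 0 := by simp [fr₁]
  have e2 : fr₂ a 0 = 0 := by simp [fr₂]
  simp only [spokeInt, e1, e2, crossInt_vertex]
  exact (crossIntSym_fr_tendsto ha hτ hdet h).div_const 2

lemma spokeInt_midpoint_tendsto {a b τ : ℝ} (ha : 0 < a) (hτ : 0 < τ) {D v : Pt}
    (hdet : det2 D v ≠ 0)
    (h : ∀ t ∈ Icc (-(τ / 2)) (τ / 2), ∀ s ∈ Icc (-1 : ℝ) 1, ∀ z,
      s • v - t • D = lvec a b z → z = 0) :
    Tendsto (fun m => spokeInt a b m τ D v ((τ / 2) • D)) atTop (𝓝 |det2 D v|⁻¹) := by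
  simp only [spokeInt, fr₁_smul, fr₂_smul, crossInt_midpoint]
  exact crossIntSym_fr_tendsto ha (half_pos hτ) hdet h

/-- The contact `e` with its two ends exchanged. -/
def rev {n : ℕ} (e : Fin n × Fin n × ℤ × ℤ) : Fin n × Fin n × ℤ × ℤ := (e.2.1, e.1, -e.2.2)

@[simp] lemma rev_rev {n : ℕ} (e : Fin n × Fin n × ℤ × ℤ) : rev (rev e) = e := by
  simp [rev]

/-- The vector from the first to the second center of a contact. -/
def edgeVec (a b : ℝ) {n : ℕ} (p : Fin n → Pt) (e : Fin n × Fin n × ℤ × ℤ) : Pt :=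
  p e.2.1 - p e.1 - lvec a b e.2.2

lemma edgeVec_rev (a b : ℝ) {n : ℕ} (p : Fin n → Pt) (e : Fin n × Fin n × ℤ × ℤ) :
    edgeVec a b p (rev e) = -edgeVec a b p e := by
  simp only [edgeVec, rev, lvec_neg]
  abel

lemma sum_rev {n : ℕ} {s : Finset (Fin n × Fin n × ℤ × ℤ)} (hs : ∀ e ∈ s, rev e ∈ s)
    {M : Type*} [AddCommMonoid M] (g : Fin n × Fin n × ℤ × ℤ → M) :
    ∑ e ∈ s, g (rev e) = ∑ e ∈ s, g e :=
  Finset.sum_nbij' rev rev hs hs (fun _ _ => rev_rev _) (fun _ _ => rev_rev _) (fun _ _ => rfl)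

/-- A stress on a toroidal framework that is balanced at every vertex and has vanishing second
moment lifts to a continuous doubly periodic function on the plane. -/
theorem exists_plane_lift {a b : ℝ} (ha : 0 < a) {n : ℕ} (p : Fin n → Pt)
    (s : Finset (Fin n × Fin n × ℤ × ℤ)) (hs : ∀ e ∈ s, rev e ∈ s)
    (ω τ : Fin n × Fin n × ℤ × ℤ → ℝ) (hω : ∀ e ∈ s, ω (rev e) = ω e)
    (hτ : ∀ e ∈ s, τ (rev e) = 1 - τ e)
    (heq : ∀ i, ∑ e ∈ s with e.1 = i, ω e • edgeVec a b p e = 0)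
    (h00 : ∑ e ∈ s, ω e * edgeVec a b p e 0 ^ 2 = 0)
    (h01 : ∑ e ∈ s, ω e * (edgeVec a b p e 0 * edgeVec a b p e 1) = 0)
    (h11 : ∑ e ∈ s, ω e * edgeVec a b p e 1 ^ 2 = 0) :
    ∃ h : Pt → ℝ, Continuous h ∧ (∀ x z, h (x + lvec a b z) = h x) ∧ (∃ x, ∀ y, h y ≤ h x) ∧
      ∀ (y v : Pt) (L : Fin n × Fin n × ℤ × ℤ → ℝ),
        (∀ e ∈ s, Tendsto (fun m => ω e * (det2 (edgeVec a b p e) v ^ 2 *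
          spokeInt a b m (τ e) (edgeVec a b p e) v (y - p e.1))) atTop (𝓝 (L e))) →
        h (y + v) + h (y - v) - 2 * h y = 2 * ∑ e ∈ s, L e := by
  set D := edgeVec a b p with hD
  have hbal : ∀ (F : Fin n → ℝ) (c₀ c₁ : ℝ),
      ∑ e ∈ s, ω e * (c₀ * D e 0 + c₁ * D e 1) * F e.1 = 0 := by
    intro F c₀ c₁
    rw [← Finset.sum_fiberwise s (fun e => e.1)]
    refine Finset.sum_eq_zero fun i _ => ?_
    have e0 := congrArg (fun x : Pt => c₀ * x 0 + c₁ * x 1) (heq i)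
    simp only [WithLp.ofLp_sum, Finset.sum_apply, PiLp.smul_apply, smul_eq_mul, PiLp.zero_apply,
      mul_zero, add_zero, Finset.mul_sum] at e0
    rw [← Finset.sum_add_distrib] at e0
    rw [← zero_mul (F i), ← e0, Finset.sum_mul]
    refine Finset.sum_congr rfl fun e he => ?_
    rw [(Finset.mem_filter.1 he).2]
    ring
  have hbal' : ∀ (F : Fin n → ℝ) (c₀ c₁ : ℝ),
      ∑ e ∈ s, ω e * (c₀ * D e 0 + c₁ * D e 1) * F e.2.1 = 0 := by
    intro F c₀ c₁
    rw [← neg_eq_zero, ← Finset.sum_neg_distrib, ← hbal F c₀ c₁, ← sum_rev hs]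
    refine Finset.sum_congr rfl fun e he => ?_
    rw [hω e he, hD, edgeVec_rev]
    simp only [rev, PiLp.neg_apply]
    ring
  have hbal2 : ∀ (f : ℝ → ℝ → ℝ), (∀ x y, f (x + 1) y = f x y) → (∀ x y, f x (y + 1) = f x y) →
      ∀ c₀ c₁ : ℝ, ∑ e ∈ s, ω e * (c₀ * D e 0 + c₁ * D e 1) *
        (f (fr₁ a b (p e.1) + fr₁ a b (D e)) (fr₂ a (p e.1) + fr₂ a (D e))
          - f (fr₁ a b (p e.1)) (fr₂ a (p e.1))) = 0 := by
    intro f hf1 hf2 c₀ c₁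
    have per : ∀ x y (k l : ℤ), f (x - k) (y - l) = f x y := by
      intro x y k l
      have p1 : Function.Periodic (fun x => f x (y - l)) 1 := fun x => hf1 _ _
      have p2 : Function.Periodic (fun y => f x y) 1 := fun y => hf2 _ _
      have q1 := p1.sub_int_mul_eq (x := x) k
      have q2 := p2.sub_int_mul_eq (x := y) l
      simp only [mul_one] at q1 q2
      rw [q1, q2]
    rw [← sub_zero (0 : ℝ)]
    nth_rewrite 1 [← hbal' (fun i => f (fr₁ a b (p i)) (fr₂ a (p i))) c₀ c₁]
    rw [← hbal (fun i => f (fr₁ a b (p i)) (fr₂ a (p i))) c₀ c₁, ← Finset.sum_sub_distrib]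
    refine Finset.sum_congr rfl fun e he => ?_
    have e1 : fr₁ a b (p e.1) + fr₁ a b (D e) = fr₁ a b (p e.2.1) - e.2.2.1 := by
      rw [hD, edgeVec, fr₁_sub, fr₁_sub, fr₁_lvec ha]
      ring
    have e2 : fr₂ a (p e.1) + fr₂ a (D e) = fr₂ a (p e.2.1) - e.2.2.2 := by
      rw [hD, edgeVec, fr₂_sub, fr₂_sub, fr₂_lvec ha]
      ring
    rw [e1, e2, per]
    ring
  have hquad : ∀ c₀ c₁ c₂ : ℝ,
      ∑ e ∈ s, ω e * (c₀ * D e 0 ^ 2 + c₁ * (D e 0 * D e 1) + c₂ * D e 1 ^ 2) = 0 := by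
    intro c₀ c₁ c₂
    have := congrArg₂ (· + ·) (congrArg₂ (· + ·) (congrArg (c₀ * ·) h00)
      (congrArg (c₁ * ·) h01)) (congrArg (c₂ * ·) h11)
    simp only [mul_zero, add_zero, Finset.mul_sum, ← Finset.sum_add_distrib] at this
    rw [← this]
    refine Finset.sum_congr rfl fun e _ => ?_
    ring
  obtain ⟨H, Hc, Hper, Hlim⟩ := exists_periodic_lift s ω (fun e => fr₁ a b (p e.1))
    (fun e => fr₂ a (p e.1)) (fun e => fr₁ a b (D e)) (fun e => fr₂ a (D e))
    (fun f hf1 hf2 => by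
      constructor
      · rw [← hbal2 f hf1 hf2 (1 / a) (-b)]
        refine Finset.sum_congr rfl fun e _ => ?_
        simp only [fr₁]
        ring
      · rw [← hbal2 f hf1 hf2 0 a]
        refine Finset.sum_congr rfl fun e _ => ?_
        simp only [fr₂]
        ring)
    (by
      rw [← hquad (1 / a ^ 2) (-2 * b / a) (b ^ 2)]
      refine Finset.sum_congr rfl fun e _ => ?_
      simp only [fr₁]
      field_simp
      ring)
    (by
      rw [← hquad 0 1 (-a * b)]
      refine Finset.sum_congr rfl fun e _ => ?_
      simp only [fr₁, fr₂]
      field_simp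
      ring)
    (by
      rw [← hquad 0 0 (a ^ 2)]
      refine Finset.sum_congr rfl fun e _ => ?_
      simp only [fr₂]
      ring)
  refine ⟨fun x => H (fr₁ a b x) (fr₂ a x), ?_, ?_, ?_, ?_⟩
  · exact Hc.comp (f := fun x => (fr₁ a b x, fr₂ a x))
      ((fr₁_continuous a b).prodMk (fr₂_continuous a))
  · intro x z
    simp only
    rw [fr₁_add, fr₂_add, fr₁_lvec ha, fr₂_lvec ha, Hper]
  · obtain ⟨q, -, hq⟩ := ((isCompact_Icc (a := (0 : ℝ)) (b := 1)).prod
      (isCompact_Icc (a := (0 : ℝ)) (b := 1))).exists_isMaxOn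
      ⟨((0 : ℝ), (0 : ℝ)), by simp⟩ Hc.continuousOn
    refine ⟨vec (a * q.1 + b * q.2) (q.2 / a), fun y => ?_⟩
    have e1 : fr₁ a b (vec (a * q.1 + b * q.2) (q.2 / a)) = q.1 := by
      simp only [fr₁, vec_zero, vec_one]
      field_simp
      ring
    have e2 : fr₂ a (vec (a * q.1 + b * q.2) (q.2 / a)) = q.2 := by
      simp only [fr₂, vec_one]
      field_simp
    show H (fr₁ a b y) (fr₂ a y) ≤ H (fr₁ a b (vec (a * q.1 + b * q.2) (q.2 / a)))
      (fr₂ a (vec (a * q.1 + b * q.2) (q.2 / a)))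
    rw [e1, e2]
    have hm : H (Int.fract (fr₁ a b y)) (Int.fract (fr₂ a y)) ≤ H q.1 q.2 :=
      hq (a := (Int.fract (fr₁ a b y), Int.fract (fr₂ a y)))
        ⟨⟨Int.fract_nonneg _, (Int.fract_lt_one _).le⟩,
          ⟨Int.fract_nonneg _, (Int.fract_lt_one _).le⟩⟩
    rw [← Hper _ _ ⌊fr₁ a b y⌋ ⌊fr₂ a y⌋, Int.fract_add_floor, Int.fract_add_floor] at hm
    exact hm
  · intro y v L hL
    have h1 := Hlim (fr₁ a b y) (fr₂ a y) (fr₁ a b v) (fr₂ a v)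
    simp only [← fr₁_add, ← fr₂_add, ← fr₁_sub, ← fr₂_sub] at h1
    refine tendsto_nhds_unique h1 ?_
    have h2 := (tendsto_finsetSum s hL).const_mul 2
    refine h2.congr fun m => ?_
    have hsplit : ∀ e ∈ s, ω e * ((fr₂ a (D e) * fr₁ a b v - fr₁ a b (D e) * fr₂ a v) ^ 2 *
        crossInt m 1 (fr₁ a b (D e)) (fr₂ a (D e)) (fr₁ a b v) (fr₂ a v)
          (fr₁ a b (y - p e.1)) (fr₂ a (y - p e.1))) =
        ω e * (det2 (D e) v ^ 2 * spokeInt a b m (τ e) (D e) v (y - p e.1)) +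
        ω (rev e) * (det2 (D (rev e)) v ^ 2 *
          spokeInt a b m (τ (rev e)) (D (rev e)) v (y - p (rev e).1)) := by
      intro e he
      have f1 : fr₁ a b (D (rev e)) = -fr₁ a b (D e) := by
        rw [hD, edgeVec_rev, ← neg_one_smul ℝ, fr₁_smul, neg_one_mul]
      have f2 : fr₂ a (D (rev e)) = -fr₂ a (D e) := by
        rw [hD, edgeVec_rev, ← neg_one_smul ℝ, fr₂_smul, neg_one_mul]
      have g : det2 (D (rev e)) v ^ 2 = det2 (D e) v ^ 2 := by
        rw [← neg_sq, ← fr_det ha b, f1, f2, ← neg_sq (det2 (D e) v), ← fr_det ha b]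
        ring
      rw [fr_det ha, neg_sq, g, hω e he, crossInt_split m (τ e), hτ e he]
      simp only [spokeInt, f1, f2]
      have c1 : fr₁ a b (y - p (rev e).1) =
          fr₁ a b (y - p e.1) - fr₁ a b (D e) - e.2.2.1 := by
        rw [← fr₁_lvec ha b e.2.2, ← fr₁_sub, ← fr₁_sub, hD, edgeVec, rev]
        congr 1
        abel
      have c2 : fr₂ a (y - p (rev e).1) =
          fr₂ a (y - p e.1) - fr₂ a (D e) - e.2.2.2 := by
        rw [← fr₂_lvec ha b e.2.2, ← fr₂_sub, ← fr₂_sub, hD, edgeVec, rev]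
        congr 1
        abel
      rw [c1, c2, crossInt_sub_int]
      ring
    rw [Finset.sum_congr rfl hsplit, Finset.sum_add_distrib,
      sum_rev hs (fun e => ω e * (det2 (D e) v ^ 2 * spokeInt a b m (τ e) (D e) v (y - p e.1)))]
    ring

lemma det2_smul_right (c : ℝ) (D v : Pt) : det2 D (c • v) = c * det2 D v := by
  simp only [det2, PiLp.smul_apply, smul_eq_mul]; ring

lemma det2_self (D : Pt) : det2 D D = 0 := by simp only [det2]; ring

lemma norm_sq_eq (x : Pt) : ‖x‖ ^ 2 = x 0 ^ 2 + x 1 ^ 2 := by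
  rw [EuclideanSpace.real_norm_sq_eq, Fin.sum_univ_two]

/-- If two disks do not overlap and a point of the second one is at most as deep in the second
disk as in the first one, then that point is the point of tangency. -/
lemma det2_eq_zero_of_tangent {P Q x D : Pt} {R S t : ℝ} (hS : 0 < S) (hPQ : R + S ≤ ‖P - Q‖)
    (hx : ‖x - P‖ - R ≤ ‖x - Q‖ - S) (hxS : ‖x - Q‖ ≤ S) (hD : x - Q = t • D) :
    det2 D (P - x) = 0 := by
  have h1 : P - Q = (P - x) + (x - Q) := by abel
  have h2 := norm_add_le (P - x) (x - Q)
  rw [← h1] at h2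
  have h3 := norm_sub_rev x P
  have h4 : ‖x - Q‖ = S := by linarith
  have h5 : ‖(P - x) + (x - Q)‖ = ‖P - x‖ + ‖x - Q‖ := by rw [← h1]; linarith
  have h6 := (sameRay_iff_norm_add (x := P - x) (y := x - Q)).2 h5
  have h7 := h6.norm_smul_eq
  rw [h4, hD] at h7
  have h8 : S * det2 D (P - x) = 0 := by
    rw [← det2_smul_right, ← h7, smul_smul, det2_smul_right, det2_self, mul_zero]
  exact (mul_eq_zero.1 h8).resolve_left hS.ne'

lemma exists_polar (D : Pt) : ∃ φ ∈ Icc (-π) π, D 0 = ‖D‖ * cos φ ∧ D 1 = ‖D‖ * sin φ := by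
  have hn : ‖(⟨D 0, D 1⟩ : ℂ)‖ = ‖D‖ := by
    rw [← sq_eq_sq₀ (norm_nonneg _) (norm_nonneg _), norm_sq_eq, Complex.sq_norm,
      Complex.normSq_mk]
    ring
  refine ⟨Complex.arg ⟨D 0, D 1⟩, ⟨(Complex.neg_pi_lt_arg _).le, Complex.arg_le_pi _⟩, ?_, ?_⟩
  · rw [← hn, Complex.norm_mul_cos_arg]
  · rw [← hn, Complex.norm_mul_sin_arg]

lemma integral_abs_det2 (D : Pt) (ρ : ℝ) (hρ : 0 ≤ ρ) :
    ∫ θ in (-π)..π, |det2 D (vec (ρ * cos θ) (ρ * sin θ))| =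
      ‖D‖ * (ρ * ∫ θ in (-π)..π, |sin θ|) := by
  obtain ⟨φ, -, h0, h1⟩ := exists_polar D
  have h : ∀ θ, |det2 D (vec (ρ * cos θ) (ρ * sin θ))| = ‖D‖ * (ρ * |sin (θ - φ)|) := by
    intro θ
    rw [det2, vec_zero, vec_one, h0, h1, sin_sub, ← abs_of_nonneg hρ, ← abs_norm D, ← abs_mul,
      ← abs_mul, abs_of_nonneg hρ, abs_norm]
    ring_nf
  have hper : Function.Periodic (fun θ => |sin θ|) (2 * π) := fun θ => by
    simp only [sin_add_two_pi]
  simp only [h]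
  rw [intervalIntegral.integral_const_mul, intervalIntegral.integral_const_mul,
    intervalIntegral.integral_comp_sub_right (fun θ => |sin θ|)]
  have e := hper.intervalIntegral_add_eq (-π - φ) (-π)
  rw [show -π - φ + 2 * π = π - φ by ring, show -π + 2 * π = π by ring] at e
  rw [e]

/-- A combination of the functions `|det2 D v|` with total weight zero that is nonpositive on a
circle vanishes there. -/
lemma sum_abs_det2_eq_zero {ι : Type*} (s : Finset ι) (ω : ι → ℝ) (D : ι → Pt) (v : Pt)
    (hω : ∑ e ∈ s, ω e * ‖D e‖ = 0)
    (hle : ∀ w : Pt, ‖w‖ = ‖v‖ → ∑ e ∈ s, ω e * |det2 (D e) w| ≤ 0) :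
    ∑ e ∈ s, ω e * |det2 (D e) v| = 0 := by
  have hv := norm_nonneg v
  set g : ℝ → ℝ := fun θ => ∑ e ∈ s, ω e * |det2 (D e) (vec (‖v‖ * cos θ) (‖v‖ * sin θ))| with hg
  have hc : ∀ e, Continuous fun θ => ω e * |det2 (D e) (vec (‖v‖ * cos θ) (‖v‖ * sin θ))| := by
    intro e
    simp only [det2, vec_zero, vec_one]
    fun_prop
  have hgc : Continuous g := continuous_finsetSum _ fun e _ => hc e
  have hnorm : ∀ θ, ‖vec (‖v‖ * cos θ) (‖v‖ * sin θ)‖ = ‖v‖ := by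
    intro θ
    rw [← sq_eq_sq₀ (norm_nonneg _) hv, norm_sq_eq, vec_zero, vec_one]
    linear_combination ‖v‖ ^ 2 * sin_sq_add_cos_sq θ
  have h_int : ∫ θ in (-π)..π, g θ = 0 := by
    simp only [hg]
    rw [intervalIntegral.integral_finsetSum fun e _ => (hc e).intervalIntegrable _ _]
    simp only [intervalIntegral.integral_const_mul, integral_abs_det2 _ _ hv, ← mul_assoc]
    rw [← Finset.sum_mul, ← Finset.sum_mul, hω, zero_mul, zero_mul]
  obtain ⟨φ, hφ, h0, h1⟩ := exists_polar v
  have hgv : ∀ θ ∈ Icc (-π) π, g θ = 0 := by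
    intro θ hθ
    by_contra hne
    have hneg : 0 < -g θ := neg_pos.2 (lt_of_le_of_ne (hle _ (hnorm θ)) hne)
    have := intervalIntegral.integral_pos (by linarith [pi_pos]) hgc.neg.continuousOn
      (fun x _ => neg_nonneg.2 (hle _ (hnorm x))) ⟨θ, hθ, hneg⟩
    simp only [Pi.neg_apply, intervalIntegral.integral_neg, h_int] at this
    simp at this
  have h2 := hgv φ hφ
  simpa only [hg, det2, vec_zero, vec_one, ← h0, ← h1] using h2

section

variable {a b : ℝ} {n : ℕ} {p : Fin n → Pt} {r : Fin n → ℝ}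

lemma IsPacking.le_norm_sub (ha : 0 < a) (hP : IsPacking (latAB a b) p r) {i l : Fin n} {z : ℤ × ℤ}
    (h : ¬(l = i ∧ z = 0)) : r i + r l ≤ ‖p i - (p l + lvec a b z)‖ := by
  have := hP.2 i l (lvec a b (-z)) (lvec_mem_latAB a b _)
    fun hh => h ⟨hh.1, neg_eq_zero.1 (lvec_eq_zero ha hh.2)⟩
  rwa [lvec_neg, ← sub_eq_add_neg, sub_sub] at this

lemma IsPacking.eq_of_mem_disks (ha : 0 < a) (hP : IsPacking (latAB a b) p r) {i l : Fin n}
    {z : ℤ × ℤ} {x : Pt} (h₁ : ‖x - p i‖ < r i) (h₂ : ‖x - (p l + lvec a b z)‖ ≤ r l) :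
    l = i ∧ z = 0 := by
  by_contra h
  have h3 := hP.le_norm_sub ha h
  have h4 : p i - (p l + lvec a b z) = (x - (p l + lvec a b z)) - (x - p i) := by abel
  rw [h4] at h3
  linarith [norm_sub_le (x - (p l + lvec a b z)) (x - p i)]

/-- The fraction of a spoke that lies in the disk around its first center. -/
def spokeLen (r : Fin n → ℝ) (e : Fin n × Fin n × ℤ × ℤ) : ℝ := r e.1 / (r e.1 + r e.2.1)

lemma spokeLen_rev (hr : ∀ i, 0 < r i) (e : Fin n × Fin n × ℤ × ℤ) :
    spokeLen r (rev e) = 1 - spokeLen r e := by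
  have h1 := hr e.1
  have h2 := hr e.2.1
  simp only [spokeLen, rev]
  field_simp
  ring

lemma spokeLen_pos (hr : ∀ i, 0 < r i) (e : Fin n × Fin n × ℤ × ℤ) : 0 < spokeLen r e :=
  div_pos (hr _) (add_pos (hr _) (hr _))

lemma spokeLen_mul (hr : ∀ i, 0 < r i) {e : Fin n × Fin n × ℤ × ℤ}
    (he : ‖edgeVec a b p e‖ = r e.1 + r e.2.1) : spokeLen r e * ‖edgeVec a b p e‖ = r e.1 := by
  have h0 : r e.1 + r e.2.1 ≠ 0 := (add_pos (hr _) (hr _)).ne'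
  rw [he, spokeLen, div_mul_cancel₀ _ h0]

/-- `h` is a potential whose second differences are the weighted counts of spoke crossings. -/
def IsLift (a b : ℝ) (p : Fin n → Pt) (r : Fin n → ℝ) (s : Finset (Fin n × Fin n × ℤ × ℤ))
    (ω : Fin n × Fin n × ℤ × ℤ → ℝ) (h : Pt → ℝ) : Prop :=
  ∀ (y v : Pt) (L : Fin n × Fin n × ℤ × ℤ → ℝ),
    (∀ e ∈ s, Tendsto (fun m => ω e * (det2 (edgeVec a b p e) v ^ 2 *
      spokeInt a b m (spokeLen r e) (edgeVec a b p e) v (y - p e.1))) atTop (𝓝 (L e))) →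
    h (y + v) + h (y - v) - 2 * h y = 2 * ∑ e ∈ s, L e

variable {s : Finset (Fin n × Fin n × ℤ × ℤ)} {ω : Fin n × Fin n × ℤ × ℤ → ℝ} {h : Pt → ℝ}

lemma IsLift.vertex (ha : 0 < a) (hP : IsPacking (latAB a b) p r)
    (hc : ∀ e ∈ s, ‖edgeVec a b p e‖ = r e.1 + r e.2.1) (hh : IsLift a b p r s ω h) {i : Fin n}
    {v : Pt} (hv : ‖v‖ < r i) :
    h (p i + v) + h (p i - v) - 2 * h (p i) =
      ∑ e ∈ s with e.1 = i, ω e * |det2 (edgeVec a b p e) v| := by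
  rw [hh (p i) v fun e => if e.1 = i then ω e * |det2 (edgeVec a b p e) v| / 2 else 0,
    Finset.sum_filter, Finset.mul_sum]
  · refine Finset.sum_congr rfl fun e _ => ?_
    split_ifs <;> ring
  intro e he
  have hτ := spokeLen_pos hP.1 e
  have hτD := spokeLen_mul hP.1 (hc e he)
  split_ifs with hi
  · by_cases hdet : det2 (edgeVec a b p e) v = 0
    · simp [hdet]
    rw [hi, sub_self]
    have e1 : ω e * |det2 (edgeVec a b p e) v| / 2 = ω e * (det2 (edgeVec a b p e) v ^ 2 *
        (|det2 (edgeVec a b p e) v|⁻¹ / 2)) := by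
      rw [← sq_abs]
      field_simp [abs_ne_zero.2 hdet]
    rw [e1]
    refine ((spokeInt_vertex_tendsto ha hτ hdet ?_).const_mul _).const_mul _
    intro t ht u hu z hz
    by_contra hz0
    have h1 := hP.le_norm_sub ha (i := i) (l := i) (z := z) (by simp [hz0])
    rw [sub_add_cancel_left, norm_neg, ← hz] at h1
    have h2 := norm_sub_le (u • v) (t • edgeVec a b p e)
    rw [norm_smul, norm_smul, Real.norm_eq_abs, Real.norm_eq_abs] at h2
    have h3 : |u| * ‖v‖ ≤ 1 * ‖v‖ := by gcongr; exact abs_le.2 hu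
    have h4 : |t| * ‖edgeVec a b p e‖ ≤ spokeLen r e * ‖edgeVec a b p e‖ := by
      gcongr; exact abs_le.2 ht
    rw [hτD, hi] at h4
    linarith
  · suffices Tendsto (fun m => spokeInt a b m (spokeLen r e) (edgeVec a b p e) v (p i - p e.1))
        atTop (𝓝 0) by
      simpa using (this.const_mul (det2 (edgeVec a b p e) v ^ 2)).const_mul (ω e)
    refine spokeInt_tendsto_zero ha hτ.le fun t ht u hu z hz => hi ?_
    refine (hP.eq_of_mem_disks ha (x := p i + u • v) (i := i) (z := z) ?_ ?_).1
    · rw [add_sub_cancel_left, norm_smul, Real.norm_eq_abs]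
      have h3 : |u| * ‖v‖ ≤ 1 * ‖v‖ := by gcongr; exact abs_le.2 hu
      linarith
    · have : p i + u • v - (p e.1 + lvec a b z) = t • edgeVec a b p e := by
        rw [← hz]; abel
      rw [this, norm_smul, Real.norm_eq_abs, abs_of_nonneg ht.1, ← hτD]
      gcongr
      exact ht.2

lemma IsLift.eq_zero_of_disk (ha : 0 < a) (hP : IsPacking (latAB a b) p r)
    (hc : ∀ e ∈ s, ‖edgeVec a b p e‖ = r e.1 + r e.2.1) (hh : IsLift a b p r s ω h) {i : Fin n}
    {M : ℝ} (hM : ∀ v, ‖v‖ < r i → h (p i + v) = M) {e : Fin n × Fin n × ℤ × ℤ} (he : e ∈ s)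
    (hi : e.1 = i) : ω e = 0 := by
  subst hi
  set D := edgeVec a b p e with hD
  set τ := spokeLen r e with hτe
  have hr := hP.1
  have hτ : 0 < τ := spokeLen_pos hr e
  have hτD : τ * ‖D‖ = r e.1 := spokeLen_mul hr (hc e he)
  have hDpos : 0 < ‖D‖ := by rw [hD, hc e he]; exact add_pos (hr _) (hr _)
  set w : Pt := vec (-D 1) (D 0) with hw
  have hwn : ‖w‖ = ‖D‖ := by
    rw [← sq_eq_sq₀ (norm_nonneg _) (norm_nonneg _), norm_sq_eq, norm_sq_eq, hw, vec_zero,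
      vec_one]
    ring
  have hdet : det2 D w = ‖D‖ ^ 2 := by
    rw [norm_sq_eq, det2, hw, vec_zero, vec_one]; ring
  have hhalf : ‖(τ / 2) • D‖ = r e.1 / 2 := by
    rw [norm_smul, Real.norm_eq_abs, abs_of_pos (half_pos hτ), ← hτD]; ring
  have hav : ∀ e' ∈ s, e' ≠ e → ∀ᶠ δ in 𝓝 (0 : ℝ), ∀ t ∈ Icc 0 (spokeLen r e'), ∀ z,
      p e.1 + (τ / 2) • D - p e'.1 + δ • w - t • edgeVec a b p e' ≠ lvec a b z := by
    intro e' he' hne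
    refine eventually_avoid ha w fun t ht z hz => hne ?_
    have hq : p e.1 + (τ / 2) • D - (p e'.1 + lvec a b z) = t • edgeVec a b p e' := by
      rw [← hz]; abel
    have h1 := hP.eq_of_mem_disks ha (x := p e.1 + (τ / 2) • D) (i := e.1) (l := e'.1) (z := z)
      (by rw [add_sub_cancel_left, hhalf]; linarith [hr e.1])
      (by
        rw [hq, norm_smul, Real.norm_eq_abs, abs_of_nonneg ht.1, ← spokeLen_mul hr (hc e' he')]
        gcongr
        exact ht.2)
    have hz0 : lvec a b z = 0 := by rw [h1.2]; simp [lvec]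
    rw [h1.1, hz0, add_zero, add_sub_cancel_left] at hq
    have ht0 : 0 < t := by
      refine lt_of_le_of_ne ht.1 fun h0 => ?_
      rw [← h0, zero_smul] at hq
      rw [hq, norm_zero] at hhalf
      linarith [hr e.1]
    have hray : SameRay ℝ D (edgeVec a b p e') :=
      Or.inr (Or.inr ⟨τ / 2, t, half_pos hτ, ht0, hq⟩)
    have h2 := hray.norm_sub
    rw [hD, hc e he, hc e' he', h1.1, add_sub_add_left_eq_sub] at h2
    have h3 : edgeVec a b p e - edgeVec a b p e' =
        p e.2.1 - (p e'.2.1 + lvec a b (e.2.2 - e'.2.2)) := by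
      simp only [edgeVec, h1.1, lvec_sub]; abel
    rw [h3] at h2
    by_contra hne'
    have h4 := hP.le_norm_sub ha (i := e.2.1) (l := e'.2.1) (z := e.2.2 - e'.2.2) (by
      rintro ⟨h5, h6⟩
      exact hne' (Prod.ext h1.1 (Prod.ext h5 (sub_eq_zero.1 h6).symm)))
    rw [h2] at h4
    rcases abs_cases (r e.2.1 - r e'.2.1) with h5 | h5 <;> linarith [hr e.2.1, hr e'.2.1]
  have hev : ∀ᶠ δ in 𝓝 (0 : ℝ), ∀ e' ∈ s, e' ≠ e → ∀ t ∈ Icc 0 (spokeLen r e'), ∀ z,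
      p e.1 + (τ / 2) • D - p e'.1 + δ • w - t • edgeVec a b p e' ≠ lvec a b z := by
    rw [Filter.eventually_all_finset]
    intro e' he'
    by_cases hne : e' = e
    · simp [hne]
    · filter_upwards [hav e' he' hne] with δ hδ _ using hδ
  obtain ⟨ε, hε, hball⟩ := Metric.eventually_nhds_iff.1 hev
  obtain ⟨δ, hδ0, hδε⟩ := exists_between (lt_min hε (show 0 < τ / 2 by positivity))
  have hδw : ‖δ • w‖ < r e.1 / 2 := by
    rw [norm_smul, Real.norm_eq_abs, abs_of_pos hδ0, hwn]
    have := mul_lt_mul_of_pos_right (hδε.trans_le (min_le_right _ _)) hDpos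
    linarith
  have hdet' : det2 D (δ • w) = δ * ‖D‖ ^ 2 := by rw [det2_smul_right, hdet]
  have hdne : det2 D (δ • w) ≠ 0 := by rw [hdet']; positivity
  have key := hh (p e.1 + (τ / 2) • D) (δ • w)
    (fun e' => if e' = e then ω e' * |det2 D (δ • w)| else 0) (by
      intro e' he'
      split_ifs with hee
      · subst hee
        rw [add_sub_cancel_left]
        have e1 : ω e' * |det2 D (δ • w)| =
            ω e' * (det2 D (δ • w) ^ 2 * |det2 D (δ • w)|⁻¹) := by
          rw [← sq_abs]
          field_simp [abs_ne_zero.2 hdne]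
        rw [e1]
        refine ((spokeInt_midpoint_tendsto ha hτ hdne ?_).const_mul _).const_mul _
        intro t ht u hu z hz
        by_contra hz0
        have h1 := hP.le_norm_sub ha (i := e'.1) (l := e'.1) (z := z) (by simp [hz0])
        rw [sub_add_cancel_left, norm_neg, ← hz] at h1
        have h2 := norm_sub_le (u • δ • w) (t • D)
        rw [norm_smul, norm_smul t, Real.norm_eq_abs, Real.norm_eq_abs] at h2
        have h3 : |u| * ‖δ • w‖ ≤ 1 * ‖δ • w‖ := by gcongr; exact abs_le.2 hu
        have h4 : |t| * ‖D‖ ≤ τ / 2 * ‖D‖ := by gcongr; exact abs_le.2 ht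
        linarith [hr e'.1]
      · suffices Tendsto (fun m => spokeInt a b m (spokeLen r e') (edgeVec a b p e') (δ • w)
            (p e.1 + (τ / 2) • D - p e'.1)) atTop (𝓝 0) by
          simpa using (this.const_mul (det2 (edgeVec a b p e') (δ • w) ^ 2)).const_mul (ω e')
        refine spokeInt_tendsto_zero ha (spokeLen_pos hr e').le fun t ht u hu z => ?_
        rw [smul_smul]
        refine hball ?_ e' he' hee t ht z
        rw [Real.dist_eq, sub_zero, abs_mul, abs_of_pos hδ0]
        have : |u| * δ ≤ 1 * δ := by gcongr; exact abs_le.2 hu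
        linarith [min_le_left ε (τ / 2)])
  have hy : ∀ v, ‖v‖ < r e.1 / 2 → h (p e.1 + (τ / 2) • D + v) = M := by
    intro v hv
    rw [add_assoc]
    exact hM _ (by linarith [norm_add_le ((τ / 2) • D) v])
  have hy0 := hy 0 (by rw [norm_zero]; exact half_pos (hr _))
  rw [add_zero] at hy0
  rw [Finset.sum_ite_eq' s e, if_pos he, sub_eq_add_neg (p e.1 + (τ / 2) • D), hy _ hδw,
    hy _ (by rwa [norm_neg]), hy0] at key
  have h0 : ω e * |det2 D (δ • w)| = 0 := by linarith
  exact (mul_eq_zero.1 h0).resolve_right (abs_ne_zero.2 hdne)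

lemma IsLift.center_eq (ha : 0 < a) (hP : IsPacking (latAB a b) p r)
    (hc : ∀ e ∈ s, ‖edgeVec a b p e‖ = r e.1 + r e.2.1) (hh : IsLift a b p r s ω h)
    (hper : ∀ x z, h (x + lvec a b z) = h x) {M : ℝ} (hM : ∀ x, h x ≤ M) {i : Fin n} {x₀ : Pt}
    (hx₀ : h x₀ = M) (hmin : ∀ e ∈ s, ω e ≠ 0 → ∀ x, h x = M →
      ‖x₀ - p i‖ - r i ≤ ‖x - p e.1‖ - r e.1)
    (hi : ∀ x, h x = M → ‖x₀ - p i‖ ≤ ‖x - p i‖) : x₀ = p i := by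
  have hr := hP.1
  by_contra hne
  set w := p i - x₀ with hw
  have hw0 : w ≠ 0 := sub_ne_zero.2 (Ne.symm hne)
  have hA : ∀ e ∈ s, ω e ≠ 0 → det2 (edgeVec a b p e) w ≠ 0 → ∀ t ∈ Icc 0 (spokeLen r e), ∀ z,
      x₀ - p e.1 - t • edgeVec a b p e ≠ lvec a b z := by
    intro e he hωe hdet t ht z hz
    apply hdet
    have hq : x₀ - (p e.1 + lvec a b z) = t • edgeVec a b p e := by rw [← hz]; abel
    have hle : ‖x₀ - (p e.1 + lvec a b z)‖ ≤ r e.1 := by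
      rw [hq, norm_smul, Real.norm_eq_abs, abs_of_nonneg ht.1, ← spokeLen_mul hr (hc e he)]
      gcongr
      exact ht.2
    by_cases hiz : e.1 = i ∧ z = 0
    · have hz0 : lvec a b z = 0 := by rw [hiz.2]; simp [lvec]
      rw [hiz.1, hz0, add_zero] at hq
      rw [hw, ← neg_sub, hq, ← neg_smul, det2_smul_right, det2_self, mul_zero]
    · refine det2_eq_zero_of_tangent (hr e.1) (hP.le_norm_sub ha hiz) ?_ hle hq
      have := hmin e he hωe (x₀ - lvec a b z) (by rw [← hper _ z, sub_add_cancel, hx₀])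
      rwa [sub_right_comm, sub_sub] at this
  have hev : ∀ᶠ δ in 𝓝 (0 : ℝ), ∀ e ∈ s, ω e ≠ 0 → det2 (edgeVec a b p e) w ≠ 0 →
      ∀ t ∈ Icc 0 (spokeLen r e), ∀ z,
      x₀ - p e.1 + δ • w - t • edgeVec a b p e ≠ lvec a b z := by
    rw [Filter.eventually_all_finset]
    intro e he
    by_cases h0 : ω e ≠ 0 ∧ det2 (edgeVec a b p e) w ≠ 0
    · filter_upwards [eventually_avoid ha w (hA e he h0.1 h0.2)] with δ hδ _ _ using hδ
    · exact Eventually.of_forall fun δ h1 h2 => absurd ⟨h1, h2⟩ h0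
  obtain ⟨ε, hε, hball⟩ := Metric.eventually_nhds_iff.1 hev
  obtain ⟨δ, hδ0, hδε⟩ := exists_between (lt_min hε one_pos)
  have key := hh x₀ (δ • w) (fun _ => 0) (by
    intro e he
    by_cases hω0 : ω e = 0
    · simp [hω0]
    by_cases hdet : det2 (edgeVec a b p e) w = 0
    · simp [det2_smul_right, hdet]
    suffices Tendsto (fun m => spokeInt a b m (spokeLen r e) (edgeVec a b p e) (δ • w)
        (x₀ - p e.1)) atTop (𝓝 0) by
      simpa using (this.const_mul (det2 (edgeVec a b p e) (δ • w) ^ 2)).const_mul (ω e)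
    refine spokeInt_tendsto_zero ha (spokeLen_pos hr e).le fun t ht u hu z => ?_
    rw [smul_smul]
    refine hball ?_ e he hω0 hdet t ht z
    rw [Real.dist_eq, sub_zero, abs_mul, abs_of_pos hδ0]
    have : |u| * δ ≤ 1 * δ := by gcongr; exact abs_le.2 hu
    linarith [min_le_left ε 1])
  rw [Finset.sum_const_zero, mul_zero, hx₀] at key
  have h1 := hi (x₀ + δ • w) (by linarith [hM (x₀ + δ • w), hM (x₀ - δ • w)])
  have h2 : x₀ + δ • w - p i = -((1 - δ) • w) := by
    rw [sub_smul, one_smul, hw]; abel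
  have hδ1 := hδε.trans_le (min_le_right _ _)
  rw [h2, norm_neg, norm_smul, Real.norm_eq_abs, abs_of_pos (sub_pos.2 hδ1), norm_sub_rev,
    ← hw] at h1
  nlinarith [mul_pos hδ0 (norm_pos_iff.2 hw0)]

/-- A balanced stress on the contacts of a toroidal packing whose second moment and radial sums
vanish is zero. -/
theorem stress_eq_zero (ha : 0 < a) (hP : IsPacking (latAB a b) p r)
    (hs : ∀ e ∈ s, rev e ∈ s) (hc : ∀ e ∈ s, ‖edgeVec a b p e‖ = r e.1 + r e.2.1)
    (hω : ∀ e ∈ s, ω (rev e) = ω e)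
    (heq : ∀ i, ∑ e ∈ s with e.1 = i, ω e • edgeVec a b p e = 0)
    (h00 : ∑ e ∈ s, ω e * edgeVec a b p e 0 ^ 2 = 0)
    (h01 : ∑ e ∈ s, ω e * (edgeVec a b p e 0 * edgeVec a b p e 1) = 0)
    (h11 : ∑ e ∈ s, ω e * edgeVec a b p e 1 ^ 2 = 0)
    (hrad : ∀ i, ∑ e ∈ s with e.1 = i, ω e * ‖edgeVec a b p e‖ = 0) : ∀ e ∈ s, ω e = 0 := by
  have hr := hP.1
  obtain ⟨h, hcont, hper, ⟨xm, hxm⟩, hh⟩ := exists_plane_lift ha p s hs ω (spokeLen r) hω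
    (fun e _ => spokeLen_rev hr e) heq h00 h01 h11
  have hlift : IsLift a b p r s ω h := hh
  by_contra! hne
  obtain ⟨e₀, he₀, hωe₀⟩ := hne
  set S : Set Pt := {x | h x = h xm} with hS
  have hScl : IsClosed S := isClosed_eq hcont continuous_const
  have hSne : S.Nonempty := ⟨xm, rfl⟩
  choose x hxS hx using fun i => hScl.exists_infDist_eq_dist hSne (p i)
  have hnear : ∀ i y, h y = h xm → ‖x i - p i‖ ≤ ‖y - p i‖ := by
    intro i y hy
    rw [← dist_eq_norm, ← dist_eq_norm, dist_comm, ← hx i, dist_comm]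
    exact Metric.infDist_le_dist_of_mem hy
  obtain ⟨e, he, hemin⟩ := Finset.exists_min_image (s.filter fun e => ω e ≠ 0)
    (fun e => ‖x e.1 - p e.1‖ - r e.1) ⟨e₀, by simp [he₀, hωe₀]⟩
  rw [Finset.mem_filter] at he
  have hctr : x e.1 = p e.1 := hlift.center_eq ha hP hc hper hxm (hxS e.1)
    (fun e' he' hωe' y hy => (hemin e' (Finset.mem_filter.2 ⟨he', hωe'⟩)).trans
      (by gcongr; exact hnear _ _ hy)) (hnear e.1)
  have hpM : h (p e.1) = h xm := hctr ▸ hxS e.1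
  have hle : ∀ v, ‖v‖ < r e.1 →
      ∑ e' ∈ s with e'.1 = e.1, ω e' * |det2 (edgeVec a b p e') v| ≤ 0 := by
    intro v hv
    rw [← hlift.vertex ha hP hc hv, hpM]
    linarith [hxm (p e.1 + v), hxm (p e.1 - v)]
  refine he.2 (hlift.eq_zero_of_disk ha hP hc (M := h xm) (fun v hv => ?_) he.1 rfl)
  have h1 := hlift.vertex ha hP hc hv
  rw [sum_abs_det2_eq_zero _ ω _ v (hrad e.1) (fun w hw => hle w (hw ▸ hv)), hpM] at h1
  linarith [hxm (p e.1 + v), hxm (p e.1 - v)]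

end

section

variable {n : ℕ}

/-- The linearized contact equation of a contact with vector `D` (up to a factor `-2`). -/
def linContact (a : ℝ) (D : Pt) (r : Fin n → ℝ) (e : Fin n × Fin n × ℤ × ℤ)
    (v : (Fin n → Pt) × (Fin n → ℝ) × ℝ × ℝ) : ℝ :=
  D 0 * (v.1 e.1 0 - v.1 e.2.1 0 + e.2.2.1 * v.2.2.1 + e.2.2.2 * v.2.2.2) +
    D 1 * (v.1 e.1 1 - v.1 e.2.1 1 - e.2.2.2 * v.2.2.1 / a ^ 2) +
    (r e.1 + r e.2.1) * (v.2.1 e.1 + v.2.1 e.2.1)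

lemma sum_union_image_rev {H : Finset (Fin n × Fin n × ℤ × ℤ)} (hH : ∀ e ∈ H, rev e ∉ H)
    {M : Type*} [AddCommMonoid M] (g : Fin n × Fin n × ℤ × ℤ → M) :
    ∑ e ∈ H ∪ H.image rev, g e = ∑ e ∈ H, (g e + g (rev e)) := by
  rw [Finset.sum_union, Finset.sum_image, Finset.sum_add_distrib]
  · intro e _ e' _ h
    rw [← rev_rev e, h, rev_rev]
  · rw [Finset.disjoint_left]
    intro e he he'
    obtain ⟨e', h, rfl⟩ := Finset.mem_image.1 he'
    exact hH e' h he

/-- The linearized contact equations of a packing are linearly independent. -/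
theorem linContact_independent {a b : ℝ} (ha : 0 < a) {p : Fin n → Pt} {r : Fin n → ℝ}
    (hP : IsPacking (latAB a b) p r) {H : Finset (Fin n × Fin n × ℤ × ℤ)}
    (hH : ∀ e ∈ H, rev e ∉ H) (hc : ∀ e ∈ H, ‖edgeVec a b p e‖ = r e.1 + r e.2.1)
    {ω : Fin n × Fin n × ℤ × ℤ → ℝ}
    (hω : ∀ v, ∑ e ∈ H, ω e * linContact a (edgeVec a b p e) r e v = 0) :
    ∀ e ∈ H, ω e = 0 := by
  classical
  set D := edgeVec a b p with hD
  set ω' : Fin n × Fin n × ℤ × ℤ → ℝ := fun e => if e ∈ H then ω e else ω (rev e) with hω'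
  have h1 : ∀ e ∈ H, ω' e = ω e := fun e he => if_pos he
  have h2 : ∀ e ∈ H, ω' (rev e) = ω e := fun e he => by simp [hω', hH e he]
  have hDr : ∀ e, D (rev e) = -D e := edgeVec_rev a b p
  have hsum : ∀ {M : Type} [AddCommGroup M] [Module ℝ M] (g : Fin n × Fin n × ℤ × ℤ → M),
      ∑ e ∈ H ∪ H.image rev, ω' e • g e = ∑ e ∈ H, ω e • (g e + g (rev e)) := by
    intro M _ _ g
    rw [sum_union_image_rev hH]
    refine Finset.sum_congr rfl fun e he => ?_
    rw [h1 e he, h2 e he, smul_add]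
  have hrsq : ∑ e ∈ H, ω e * (D e 0 ^ 2 + D e 1 ^ 2) = 0 := by
    have := hω (0, r, 0, 0)
    simp only [linContact, Pi.zero_apply, PiLp.zero_apply] at this
    rw [← this]
    refine Finset.sum_congr rfl fun e he => ?_
    rw [← norm_sq_eq, hc e he]
    ring
  have hα := hω (0, 0, 1, 0)
  have hβ := hω (0, 0, 0, 1)
  have hq00 := hω (fun i => vec (p i 0) 0, 0, 0, 0)
  have hq10 := hω (fun i => vec (p i 1) 0, 0, 0, 0)
  have hq11 := hω (fun i => vec 0 (p i 1), 0, 0, 0)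
  have hq : ∀ i u, ∑ e ∈ H, ω e * linContact a (D e) r e (Pi.single i u, 0, 0, 0) = 0 :=
    fun i u => hω _
  have hρ : ∀ i, ∑ e ∈ H, ω e * linContact a (D e) r e (0, Pi.single i 1, 0, 0) = 0 :=
    fun i => hω _
  simp only [linContact, vec_zero, vec_one, Pi.zero_apply, PiLp.zero_apply, mul_zero, mul_one,
    add_zero, sub_zero, zero_add, zero_sub, zero_div, sub_self]
    at hα hβ hq00 hq10 hq11 hq hρ
  have hD0 : ∀ e, D e 0 = p e.2.1 0 - p e.1 0 - (e.2.2.1 * a + e.2.2.2 * b) := fun e => by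
    rw [← lvec_zero_apply]; rfl
  have hD1 : ∀ e, D e 1 = p e.2.1 1 - p e.1 1 - e.2.2.2 * (1 / a) := fun e => by
    rw [← lvec_one_apply]; rfl
  have m01 : ∑ e ∈ H, ω e * (D e 0 * D e 1) = 0 := by
    have : ∑ e ∈ H, ω e * (D e 0 * D e 1) = -∑ e ∈ H, ω e * (D e 0 * (p e.1 1 - p e.2.1 1))
        - (1 / a) * ∑ e ∈ H, ω e * (D e 0 * e.2.2.2) := by
      rw [Finset.mul_sum, ← Finset.sum_neg_distrib, ← Finset.sum_sub_distrib]
      refine Finset.sum_congr rfl fun e _ => ?_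
      rw [hD1]; ring
    rw [this, hq10, hβ]; simp
  have mdiff : ∑ e ∈ H, ω e * (D e 0 ^ 2 - D e 1 ^ 2) = 0 := by
    have : ∑ e ∈ H, ω e * (D e 0 ^ 2 - D e 1 ^ 2) =
        -∑ e ∈ H, ω e * (D e 0 * (p e.1 0 - p e.2.1 0))
        + ∑ e ∈ H, ω e * (D e 1 * (p e.1 1 - p e.2.1 1))
        - a * ∑ e ∈ H, ω e * (D e 0 * e.2.2.1 + D e 1 * -(e.2.2.2 / a ^ 2))
        - b * ∑ e ∈ H, ω e * (D e 0 * e.2.2.2) := by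
      rw [Finset.mul_sum, Finset.mul_sum, ← Finset.sum_neg_distrib, ← Finset.sum_add_distrib,
        ← Finset.sum_sub_distrib, ← Finset.sum_sub_distrib]
      refine Finset.sum_congr rfl fun e _ => ?_
      have e1 : D e 0 ^ 2 - D e 1 ^ 2 = D e 0 * D e 0 - D e 1 * D e 1 := by ring
      rw [e1]
      nth_rewrite 2 [hD0]
      nth_rewrite 2 [hD1]
      field_simp
      ring
    rw [this, hq00, hq11, hβ, hα]; simp
  have m00 : ∑ e ∈ H, ω e * D e 0 ^ 2 = 0 := by
    have h3 : ∑ e ∈ H, ω e * (D e 0 ^ 2 + D e 1 ^ 2) + ∑ e ∈ H, ω e * (D e 0 ^ 2 - D e 1 ^ 2) =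
        2 * ∑ e ∈ H, ω e * D e 0 ^ 2 := by
      rw [← Finset.sum_add_distrib, Finset.mul_sum]
      exact Finset.sum_congr rfl fun e _ => by ring
    rw [hrsq, mdiff] at h3
    linarith
  have m11 : ∑ e ∈ H, ω e * D e 1 ^ 2 = 0 := by
    rw [← hrsq, ← sub_eq_zero, ← Finset.sum_sub_distrib, ← neg_eq_zero, ← Finset.sum_neg_distrib,
      ← m00]
    exact Finset.sum_congr rfl fun e _ => by ring
  have key := stress_eq_zero (ω := ω') (s := H ∪ H.image rev) ha hP ?_ ?_ ?_ ?_ ?_ ?_ ?_ ?_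
  · intro e he
    rw [← h1 e he]
    exact key e (Finset.mem_union_left _ he)
  · intro e he
    rcases Finset.mem_union.1 he with he | he
    · exact Finset.mem_union_right _ (Finset.mem_image_of_mem _ he)
    · obtain ⟨e', he', rfl⟩ := Finset.mem_image.1 he
      rw [rev_rev]
      exact Finset.mem_union_left _ he'
  · intro e he
    rcases Finset.mem_union.1 he with he | he
    · exact hc e he
    · obtain ⟨e', he', rfl⟩ := Finset.mem_image.1 he
      rw [edgeVec_rev, norm_neg, hc e' he', add_comm]
      rfl
  · intro e he
    rcases Finset.mem_union.1 he with he | he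
    · rw [h1 e he, h2 e he]
    · obtain ⟨e', he', rfl⟩ := Finset.mem_image.1 he
      rw [rev_rev, h1 e' he', h2 e' he']
  · intro i
    rw [Finset.sum_filter]
    have e1 : ∀ e, (if e.1 = i then ω' e • D e else 0) = ω' e • (if e.1 = i then D e else 0) :=
      fun e => by split_ifs <;> simp
    simp only [← hD, e1, hsum, hDr]
    have e2 := hq i (vec 1 0)
    have e3 := hq i (vec 0 1)
    ext j
    fin_cases j
    · simp only [Fin.zero_eta, WithLp.ofLp_sum, Finset.sum_apply, PiLp.zero_apply]
      rw [← e2]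
      refine Finset.sum_congr rfl fun e _ => ?_
      by_cases h3 : e.1 = i <;> by_cases h4 : e.2.1 = i <;>
        simp [rev, h3, h4, vec_zero, vec_one]
    · simp only [Fin.mk_one, WithLp.ofLp_sum, Finset.sum_apply, PiLp.zero_apply]
      rw [← e3]
      refine Finset.sum_congr rfl fun e _ => ?_
      by_cases h3 : e.1 = i <;> by_cases h4 : e.2.1 = i <;>
        simp [rev, h3, h4, vec_zero, vec_one]
  · have := hsum (fun e => D e 0 ^ 2)
    simp only [smul_eq_mul] at this
    rw [this]
    have e1 : ∀ e, D e 0 ^ 2 + D (rev e) 0 ^ 2 = 2 * D e 0 ^ 2 := fun e => by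
      rw [hDr, PiLp.neg_apply]; ring
    simp only [e1, mul_left_comm _ (2 : ℝ), ← Finset.mul_sum, m00, mul_zero]
  · have := hsum (fun e => D e 0 * D e 1)
    simp only [smul_eq_mul] at this
    rw [this]
    have e1 : ∀ e, D e 0 * D e 1 + D (rev e) 0 * D (rev e) 1 = 2 * (D e 0 * D e 1) := fun e => by
      rw [hDr, PiLp.neg_apply, PiLp.neg_apply]; ring
    simp only [e1, mul_left_comm _ (2 : ℝ), ← Finset.mul_sum, m01, mul_zero]
  · have := hsum (fun e => D e 1 ^ 2)
    simp only [smul_eq_mul] at this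
    rw [this]
    have e1 : ∀ e, D e 1 ^ 2 + D (rev e) 1 ^ 2 = 2 * D e 1 ^ 2 := fun e => by
      rw [hDr, PiLp.neg_apply]; ring
    simp only [e1, mul_left_comm _ (2 : ℝ), ← Finset.mul_sum, m11, mul_zero]
  · intro i
    rw [Finset.sum_filter]
    have e1 : ∀ e, (if e.1 = i then ω' e * ‖D e‖ else 0) = ω' e • (if e.1 = i then ‖D e‖ else 0) :=
      fun e => by split_ifs <;> simp
    simp only [← hD, e1, hsum, hDr, norm_neg]
    refine (Finset.sum_congr rfl fun e he => ?_).trans (hρ i)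
    rw [hc e he, smul_eq_mul]
    refine congrArg (ω e * ·) ?_
    by_cases h3 : e.1 = i <;> by_cases h4 : e.2.1 = i <;>
      simp [rev, h3, h4, mul_add]

end

section

variable {n : ℕ}

/-- The squared contact equation of the edge `e`. -/
def edgeFun (e : Fin n × Fin n × ℤ × ℤ) (x : (Fin n → Pt) × (Fin n → ℝ) × ℝ × ℝ) : ℝ :=
  (x.1 e.1 0 - x.1 e.2.1 0 + (e.2.2.1 * x.2.2.1 + e.2.2.2 * x.2.2.2)) ^ 2 +
    (x.1 e.1 1 - x.1 e.2.1 1 + e.2.2.2 * x.2.2.1⁻¹) ^ 2 - (x.2.1 e.1 + x.2.1 e.2.1) ^ 2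

lemma edgeFun_eq (e : Fin n × Fin n × ℤ × ℤ) (x : (Fin n → Pt) × (Fin n → ℝ) × ℝ × ℝ) :
    edgeFun e x = ‖x.1 e.1 - x.1 e.2.1 + lvec x.2.2.1 x.2.2.2 e.2.2‖ ^ 2 -
      (x.2.1 e.1 + x.2.1 e.2.1) ^ 2 := by
  rw [norm_sq_eq, edgeFun]
  simp [lvec_zero_apply, lvec_one_apply]

lemma hasStrictFDerivAt_edgeFun (e : Fin n × Fin n × ℤ × ℤ)
    {x : (Fin n → Pt) × (Fin n → ℝ) × ℝ × ℝ} (ha : x.2.2.1 ≠ 0) :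
    ∃ f' : (Fin n → Pt) × (Fin n → ℝ) × ℝ × ℝ →L[ℝ] ℝ, HasStrictFDerivAt (edgeFun e) f' x ∧
      ∀ v, f' v = -2 * linContact x.2.2.1 (edgeVec x.2.2.1 x.2.2.2 x.1 e) x.2.1 e v := by
  let P : Fin n → Fin 2 → (Fin n → Pt) × (Fin n → ℝ) × ℝ × ℝ →L[ℝ] ℝ := fun i j =>
    (EuclideanSpace.proj j).comp
      ((ContinuousLinearMap.proj (R := ℝ) (φ := fun _ : Fin n => Pt) i).comp
        (ContinuousLinearMap.fst ℝ _ _))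
  let R : Fin n → (Fin n → Pt) × (Fin n → ℝ) × ℝ × ℝ →L[ℝ] ℝ := fun i =>
    (ContinuousLinearMap.proj (R := ℝ) (φ := fun _ : Fin n => ℝ) i).comp
      ((ContinuousLinearMap.fst ℝ _ _).comp (ContinuousLinearMap.snd ℝ _ _))
  let A : (Fin n → Pt) × (Fin n → ℝ) × ℝ × ℝ →L[ℝ] ℝ :=
    (ContinuousLinearMap.fst ℝ _ _).comp
      ((ContinuousLinearMap.snd ℝ _ _).comp (ContinuousLinearMap.snd ℝ _ _))
  let B : (Fin n → Pt) × (Fin n → ℝ) × ℝ × ℝ →L[ℝ] ℝ :=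
    (ContinuousLinearMap.snd ℝ _ _).comp
      ((ContinuousLinearMap.snd ℝ _ _).comp (ContinuousLinearMap.snd ℝ _ _))
  have h0 : HasStrictFDerivAt (fun x : (Fin n → Pt) × (Fin n → ℝ) × ℝ × ℝ =>
      x.1 e.1 0 - x.1 e.2.1 0 + (e.2.2.1 * x.2.2.1 + e.2.2.2 * x.2.2.2))
      (P e.1 0 - P e.2.1 0 + ((e.2.2.1 : ℝ) • A + (e.2.2.2 : ℝ) • B)) x :=
    (P e.1 0 - P e.2.1 0 + ((e.2.2.1 : ℝ) • A + (e.2.2.2 : ℝ) • B)).hasStrictFDerivAt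
  have hA : HasStrictFDerivAt (fun x : (Fin n → Pt) × (Fin n → ℝ) × ℝ × ℝ => x.2.2.1⁻¹)
      ((-(x.2.2.1 ^ 2)⁻¹) • A) x :=
    (hasStrictDerivAt_inv ha).comp_hasStrictFDerivAt x A.hasStrictFDerivAt
  have h1 : HasStrictFDerivAt (fun x : (Fin n → Pt) × (Fin n → ℝ) × ℝ × ℝ =>
      x.1 e.1 1 - x.1 e.2.1 1 + e.2.2.2 * x.2.2.1⁻¹)
      (P e.1 1 - P e.2.1 1 + (e.2.2.2 : ℝ) • ((-(x.2.2.1 ^ 2)⁻¹) • A)) x :=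
    (P e.1 1 - P e.2.1 1).hasStrictFDerivAt.add (hA.const_mul (e.2.2.2 : ℝ))
  have h2 : HasStrictFDerivAt (fun x : (Fin n → Pt) × (Fin n → ℝ) × ℝ × ℝ =>
      x.2.1 e.1 + x.2.1 e.2.1) (R e.1 + R e.2.1) x := (R e.1 + R e.2.1).hasStrictFDerivAt
  refine ⟨_, ((h0.pow 2).add (h1.pow 2)).sub (h2.pow 2), fun v => ?_⟩
  simp [P, R, A, B, linContact, edgeVec, lvec_zero_apply, lvec_one_apply]
  field_simp
  ring

/-- The contact equations of `H` together with the normalization of the first center. -/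
def contactMap (i₀ : Fin n) (H : Finset (Fin n × Fin n × ℤ × ℤ))
    (x : (Fin n → Pt) × (Fin n → ℝ) × ℝ × ℝ) : Pt × (H → ℝ) :=
  (x.1 i₀, fun e => edgeFun e x)

/-- The contact equations are a submersion at every packing. -/
lemma hasStrictFDerivAt_contactMap (i₀ : Fin n) {H : Finset (Fin n × Fin n × ℤ × ℤ)}
    (hH : ∀ e ∈ H, rev e ∉ H) {x : (Fin n → Pt) × (Fin n → ℝ) × ℝ × ℝ} (ha : 0 < x.2.2.1)
    (hP : IsPacking (latAB x.2.2.1 x.2.2.2) x.1 x.2.1)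
    (hc : ∀ e ∈ H, ‖edgeVec x.2.2.1 x.2.2.2 x.1 e‖ = x.2.1 e.1 + x.2.1 e.2.1) :
    ∃ f' : (Fin n → Pt) × (Fin n → ℝ) × ℝ × ℝ →L[ℝ] Pt × (H → ℝ),
      HasStrictFDerivAt (contactMap i₀ H) f' x ∧ f'.range = ⊤ := by
  classical
  choose g hg hgv using fun e => hasStrictFDerivAt_edgeFun (n := n) e ha.ne'
  let P : (Fin n → Pt) × (Fin n → ℝ) × ℝ × ℝ →L[ℝ] Pt :=
    (ContinuousLinearMap.proj (R := ℝ) (φ := fun _ : Fin n => Pt) i₀).comp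
      (ContinuousLinearMap.fst ℝ _ _)
  refine ⟨P.prod (ContinuousLinearMap.pi fun e : H => g e),
    P.hasStrictFDerivAt.prodMk (hasStrictFDerivAt_pi.2 fun e => hg e), ?_⟩
  by_contra hne
  obtain ⟨f, hf0, hf⟩ := Submodule.exists_le_ker_of_lt_top _ (lt_top_iff_ne_top.2 hne)
  have hfv : ∀ v, f (P v, fun e : H => g e v) = 0 := fun v => hf ⟨v, rfl⟩
  have hpt : ∀ u : Pt, f (u, 0) = 0 := fun u => by
    rw [← hfv (fun _ => u, 0, 0, 0)]
    congr 2
    funext e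
    rw [hgv]
    simp [linContact]
  have hdec : ∀ u w, f (u, w) = ∑ e : H, w e * f (0, Pi.single e 1) := fun u w => by
    have : (u, w) = (u, (0 : H → ℝ)) + ∑ e : H, w e • ((0 : Pt), Pi.single e (1 : ℝ)) := by
      ext1
      · simp [Prod.fst_sum]
      · simp only [Prod.snd_add, Prod.snd_sum, Prod.smul_snd, zero_add]
        funext e
        simp [Finset.sum_apply, Pi.single_apply]
    rw [this, map_add, hpt, zero_add, map_sum]
    simp only [map_smul, smul_eq_mul]
  set ω : Fin n × Fin n × ℤ × ℤ → ℝ :=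
    fun e => if h : e ∈ H then f (0, Pi.single ⟨e, h⟩ 1) else 0 with hω
  have hω' : ∀ e : H, ω e = f (0, Pi.single e 1) := fun e => by simp [hω]
  have hz := linContact_independent (ω := ω) ha hP hH hc fun v => by
    have := hfv v
    rw [hdec] at this
    simp only [hgv, ← hω'] at this
    rw [← Finset.sum_coe_sort]
    have h2 : ∑ e : H, ω e * linContact x.2.2.1 (edgeVec x.2.2.1 x.2.2.2 x.1 e) x.2.1 e v =
        (-1 / 2) * ∑ e : H, -2 * linContact x.2.2.1 (edgeVec x.2.2.1 x.2.2.2 x.1 e) x.2.1 e v *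
          ω e := by
      rw [Finset.mul_sum]
      exact Finset.sum_congr rfl fun e _ => by ring
    rw [h2, this, mul_zero]
  refine hf0 (LinearMap.ext fun ⟨u, w⟩ => ?_)
  rw [hdec]
  exact Finset.sum_eq_zero fun e _ => by rw [← hω', hz e e.2, mul_zero]

/-- A level set of a submersion at each of its points has the expected dimension. -/
theorem dimH_le_of_submersion {E F : Type*} [NormedAddCommGroup E] [NormedSpace ℝ E]
    [FiniteDimensional ℝ E] [NormedAddCommGroup F] [NormedSpace ℝ F] [FiniteDimensional ℝ F]
    {f : E → F} {X : Set E} {c : F} (hX : ∀ x ∈ X, f x = c)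
    (hf : ∀ x ∈ X, ∃ f' : E →L[ℝ] F, HasStrictFDerivAt f f' x ∧ f'.range = ⊤) :
    dimH X ≤ ((Module.finrank ℝ E - Module.finrank ℝ F : ℕ) : ENNReal) := by
  by_contra! hlt
  obtain ⟨x, hx, hdim⟩ := exists_mem_nhdsWithin_lt_dimH_of_lt_dimH hlt
  obtain ⟨f', hf', hr⟩ := hf x hx
  have := FiniteDimensional.complete ℝ E
  obtain ⟨K, s, hs, hK⟩ := (hf'.to_implicitFunction hr).exists_lipschitzOnWith
  set Φ := hf'.implicitToOpenPartialHomeomorph f f' hr with hΦ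
  have hcont : ContinuousAt (fun y => (Φ y).2) x :=
    (Φ.continuousAt (hf'.mem_implicitToOpenPartialHomeomorph_source hr)).snd
  have h0 : (Φ x).2 = 0 := by simp [hΦ]
  have hev : ∀ᶠ y in 𝓝 x, (Φ y).2 ∈ s ∧ hf'.implicitFunction f f' hr (f y) (Φ y).2 = y :=
    (hcont.eventually (by change s ∈ 𝓝 (Φ x).2; rwa [h0])).and (hf'.eq_implicitFunction hr)
  have hmem : {y ∈ X | (Φ y).2 ∈ s ∧ hf'.implicitFunction f f' hr (f y) (Φ y).2 = y} ∈ 𝓝[X] x :=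
    inter_mem self_mem_nhdsWithin (mem_nhdsWithin_of_mem_nhds hev)
  refine (hdim _ hmem).not_ge ?_
  have hsub : {y ∈ X | (Φ y).2 ∈ s ∧ hf'.implicitFunction f f' hr (f y) (Φ y).2 = y} ⊆
      hf'.implicitFunction f f' hr (f x) '' s := by
    rintro y ⟨hy, hys, hyy⟩
    refine ⟨_, hys, ?_⟩
    rwa [hX x hx, ← hX y hy]
  refine (dimH_mono hsub).trans (hK.dimH_image_le.trans ((dimH_mono (subset_univ s)).trans ?_))
  rw [Real.dimH_univ_eq_finrank]
  have := f'.toLinearMap.finrank_range_add_finrank_ker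
  have h2 : Module.finrank ℝ f'.toLinearMap.range = Module.finrank ℝ F := by
    have h3 : f'.toLinearMap.range = ⊤ := hr
    rw [h3, finrank_top]
  have h4 : Module.finrank ℝ f'.ker =
    Module.finrank ℝ E - Module.finrank ℝ F := by
    have h5 : Module.finrank ℝ f'.ker = Module.finrank ℝ f'.toLinearMap.ker := rfl
    omega
  exact_mod_cast h4.le

end

section

variable {n : ℕ}

lemma rev_mem_contactGraphZ {a b : ℝ} {p : Fin n → Pt} {r : Fin n → ℝ}
    {e : Fin n × Fin n × ℤ × ℤ} (he : e ∈ contactGraphZ a b p r) :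
    rev e ∈ contactGraphZ a b p r := by
  obtain ⟨h1, h2⟩ := he
  refine ⟨fun ⟨h3, h4⟩ => h1 ⟨h3.symm, neg_eq_zero.1 h4⟩, ?_⟩
  change ‖p e.2.1 - p e.1 + lvec a b (-e.2.2)‖ = r e.2.1 + r e.1
  rw [lvec_neg, add_comm (r _), ← h2, ← norm_neg]
  congr 1
  abel

lemma rev_ne_of_mem_contactGraphZ {a b : ℝ} {p : Fin n → Pt} {r : Fin n → ℝ}
    {e : Fin n × Fin n × ℤ × ℤ} (he : e ∈ contactGraphZ a b p r) : rev e ≠ e := fun h => by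
  have h1 : e.2.1 = e.1 := congrArg Prod.fst h
  have h2 : -e.2.2.1 = e.2.2.1 := congrArg (fun e => e.2.2.1) h
  have h3 : -e.2.2.2 = e.2.2.2 := congrArg (fun e => e.2.2.2) h
  exact he.1 ⟨h1, Prod.ext (by simp; omega) (by simp; omega)⟩

lemma norm_edgeVec_of_mem_contactGraphZ {a b : ℝ} {p : Fin n → Pt} {r : Fin n → ℝ}
    {e : Fin n × Fin n × ℤ × ℤ} (he : e ∈ contactGraphZ a b p r) :
    ‖edgeVec a b p e‖ = r e.1 + r e.2.1 := by
  rw [← he.2, ← norm_neg, edgeVec]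
  congr 1
  abel

/-- A fixed-point free involution on a finite set with `2 * k` elements has a transversal with
`k` elements. -/
lemma exists_transversal {α : Type*} {f : α → α} (hf : ∀ x, f (f x) = x) {s : Set α}
    (hs : ∀ x ∈ s, f x ∈ s) (hne : ∀ x ∈ s, f x ≠ x) {k : ℕ} (hk : s.ncard = 2 * k) :
    ∃ t : Finset α, ↑t ⊆ s ∧ (∀ x ∈ t, f x ∉ t) ∧ t.card = k := by
  classical
  rcases s.finite_or_infinite with hfin | hinf
  swap
  · refine ⟨∅, by simp, by simp, ?_⟩
    rw [hinf.ncard] at hk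
    rw [Finset.card_empty]; omega
  lift s to Finset α using hfin
  rw [Set.ncard_coe_finset] at hk
  set t := s.filter fun x => WellOrderingRel x (f x) with ht
  have hdisj : ∀ x ∈ t, f x ∉ t := fun x hx hfx => by
    rw [ht, Finset.mem_filter] at hx hfx
    rw [hf] at hfx
    exact asymm hx.2 hfx.2
  refine ⟨t, Finset.coe_subset.2 (s.filter_subset _), hdisj, ?_⟩
  have h1 : s = t ∪ t.image f := by
    ext x
    refine ⟨fun hx => ?_, fun hx => ?_⟩
    · rcases trichotomous_of WellOrderingRel x (f x) with h | h | h
      · exact Finset.mem_union_left _ (Finset.mem_filter.2 ⟨hx, h⟩)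
      · exact absurd h.symm (hne x hx)
      · refine Finset.mem_union_right _ (Finset.mem_image.2 ⟨f x, ?_, hf x⟩)
        exact Finset.mem_filter.2 ⟨hs x hx, by rwa [hf]⟩
    · rcases Finset.mem_union.1 hx with h | h
      · exact (Finset.mem_filter.1 h).1
      · obtain ⟨y, hy, rfl⟩ := Finset.mem_image.1 h
        exact hs y (Finset.mem_filter.1 hy).1
  rw [h1, Finset.card_union_of_disjoint, Finset.card_image_of_injective] at hk
  · omega
  · exact fun x y h => by rw [← hf x, h, hf]
  · rw [Finset.disjoint_left]
    intro x hx hx'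
    obtain ⟨y, hy, rfl⟩ := Finset.mem_image.1 hx'
    exact hdisj y hy hx

end

end

/-- **Corollary 6.2.**  If the fixed contact graph `G` has `k` edges (its set of
ordered contact triples has `2k` elements), then the Hausdorff dimension of
`X(n, CJ(G))` is at most `3n - k`. -/
theorem dimH_XnCJG_le
    (n : ℕ) (hn : 0 < n) (G : Set (Fin n × Fin n × ℤ × ℤ))
    (k : ℕ) (hk : G.ncard = 2 * k) :
    dimH (XnCJG n hn G) ≤ ((3 * n - k : ℕ) : ENNReal) := by
  rcases (XnCJG n hn G).eq_empty_or_nonempty with hX | ⟨x₀, -, rfl⟩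
  · simp [hX]
  obtain ⟨H, hHG, hH, rfl⟩ := exists_transversal rev_rev (fun e => rev_mem_contactGraphZ)
    (fun e => rev_ne_of_mem_contactGraphZ) hk
  refine (dimH_le_of_submersion (f := contactMap ⟨0, hn⟩ H) (c := 0) ?_ ?_).trans ?_
  · rintro x ⟨⟨h0, -⟩, hG⟩
    refine Prod.ext h0 (funext fun e => ?_)
    have he := hHG e.2
    rw [← hG] at he
    change edgeFun e.1 x = 0
    rw [edgeFun_eq, he.2, sub_self]
  · rintro x ⟨⟨-, ha, hP, -⟩, hG⟩
    refine hasStrictFDerivAt_contactMap _ hH ha hP fun e he => ?_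
    exact norm_edgeVec_of_mem_contactGraphZ (hG ▸ hHG he)
  · have : Module.finrank ℝ ((Fin n → Pt) × (Fin n → ℝ) × ℝ × ℝ) -
        Module.finrank ℝ (Pt × (H → ℝ)) = 3 * n - H.card := by
      simp [Module.finrank_prod, Module.finrank_pi_fintype]
      omega
    rw [this]

end IsostaticPaper
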